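/- Let A_1, A_2 be commuting matrices in GL(ρ,ℤ) such that the ℤ²-action ℓ ↦ A^ℓ := A_1^{ℓ_1} A_2^{ℓ_2} on the torus 𝕋^ρ is totally ergodic, i.e., for every ℓ ∈ ℤ² with ℓ ≠ 0, A^ℓ has no eigenvalue which is a root of unity. Then the set F of triples (ℓ_1, ℓ_2, ℓ_3) ∈ (ℤ²)³ for which there exists γ ∈ ℤ^ρ, γ ≠ 0, with A^{ℓ_1}γ − A^{ℓ_2}γ + A^{ℓ_3}γ − γ = 0 and such that no proper subsum vanishes (i.e., no nonempty proper subfamily of the four vectors A^{ℓ_1}γ, −A^{ℓ_2}γ, A^{ℓ_3}γ, −γ has sum zero), is finite. -/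

import Mathlib

open Matrix

/-- The matrix `A^ℓ = A₁^{ℓ₁} A₂^{ℓ₂}` of the `ℤ²`-action generated by two commuting
elements of `GL(ρ, ℤ)`. -/
def Apow {ρ : ℕ} (A₁ A₂ : Matrix.GeneralLinearGroup (Fin ρ) ℤ) (ℓ : ℤ × ℤ) :
    Matrix (Fin ρ) (Fin ρ) ℤ :=
  ((A₁ ^ ℓ.1 * A₂ ^ ℓ.2 : Matrix.GeneralLinearGroup (Fin ρ) ℤ) : Matrix (Fin ρ) (Fin ρ) ℤ)

/-- Distinct natural numbers have a large sum. -/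
theorem Finset.card_choose_two_le_sum_of_injective {ι : Type*} [Fintype ι] {p : ι → ℕ}
    (hp : Function.Injective p) : (Fintype.card ι).choose 2 ≤ ∑ i, p i := by
  classical
  have h := Finset.sum_range_le_sum (s := Finset.univ.image fun i => (p i : ℤ)) (c := 0)
    (by simp)
  rw [Finset.sum_image (fun i _ j _ h => hp (by exact_mod_cast h)),
    Finset.card_image_of_injective _ (fun i j h => hp (by exact_mod_cast h)),
    Finset.card_univ] at h
  simp only [zero_add] at h
  rw [Nat.choose_two_right, ← Finset.sum_range_id]
  zify
  exact h

/-- A determinant whose entries are bounded by `M`. -/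
theorem Matrix.norm_det_le {ι : Type*} [Fintype ι] [DecidableEq ι] {A : Matrix ι ι ℂ} {M : ℝ}
    (h : ∀ i j, ‖A i j‖ ≤ M) :
    ‖A.det‖ ≤ (Fintype.card ι).factorial * M ^ Fintype.card ι := by
  have := Matrix.det_le (abv := NormedField.toAbsoluteValue ℂ) h
  rwa [nsmul_eq_mul] at this

theorem norm_prod_sub_prod_le {ι : Type*} (s : Finset ι) (f g : ι → ℂ) {M η : ℝ} (hM : 1 ≤ M)
    (hf : ∀ i ∈ s, ‖f i‖ ≤ M) (hg : ∀ i ∈ s, ‖g i‖ ≤ M) (hfg : ∀ i ∈ s, ‖f i - g i‖ ≤ η) :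
    ‖∏ i ∈ s, f i - ∏ i ∈ s, g i‖ ≤ s.card * M ^ s.card * η := by
  classical
  induction s using Finset.induction_on with
  | empty => simp
  | insert a s ha ih =>
    have ih' := ih (fun i hi => hf i (Finset.mem_insert_of_mem hi))
      (fun i hi => hg i (Finset.mem_insert_of_mem hi))
      (fun i hi => hfg i (Finset.mem_insert_of_mem hi))
    have hη : 0 ≤ η := (norm_nonneg _).trans (hfg a (Finset.mem_insert_self _ _))
    have hprod : ‖∏ i ∈ s, g i‖ ≤ M ^ s.card := by
      rw [norm_prod, ← Finset.prod_const]
      exact Finset.prod_le_prod (fun _ _ => norm_nonneg _)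
        (fun i hi => hg i (Finset.mem_insert_of_mem hi))
    have hpow : M ^ s.card ≤ M ^ (s.card + 1) := pow_le_pow_right₀ hM (Nat.le_succ _)
    rw [Finset.prod_insert ha, Finset.prod_insert ha, Finset.card_insert_of_notMem ha]
    calc ‖f a * ∏ i ∈ s, f i - g a * ∏ i ∈ s, g i‖
        = ‖f a * (∏ i ∈ s, f i - ∏ i ∈ s, g i) + (f a - g a) * ∏ i ∈ s, g i‖ := by ring_nf
      _ ≤ ‖f a‖ * ‖∏ i ∈ s, f i - ∏ i ∈ s, g i‖ + ‖f a - g a‖ * ‖∏ i ∈ s, g i‖ := by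
          rw [← norm_mul, ← norm_mul]
          exact norm_add_le _ _
      _ ≤ M * (s.card * M ^ s.card * η) + η * M ^ (s.card + 1) := by
          gcongr
          · exact hf a (Finset.mem_insert_self _ _)
          · exact hfg a (Finset.mem_insert_self _ _)
          · exact hprod.trans hpow
      _ = ((s.card + 1 : ℕ) : ℝ) * M ^ (s.card + 1) * η := by push_cast; ring

/-- Perturbation bound for determinants. -/
theorem Matrix.norm_det_sub_det_le {ι : Type*} [Fintype ι] [DecidableEq ι] {A B : Matrix ι ι ℂ}
    {M η : ℝ} (hM : 1 ≤ M) (hA : ∀ i j, ‖A i j‖ ≤ M) (hB : ∀ i j, ‖B i j‖ ≤ M)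
    (hAB : ∀ i j, ‖A i j - B i j‖ ≤ η) :
    ‖A.det - B.det‖ ≤
      (Fintype.card ι).factorial * (Fintype.card ι * M ^ Fintype.card ι * η) := by
  rw [Matrix.det_apply, Matrix.det_apply, ← Finset.sum_sub_distrib]
  calc _ ≤ ∑ σ : Equiv.Perm ι, ‖∏ i, A (σ i) i - ∏ i, B (σ i) i‖ := by
        refine (norm_sum_le _ _).trans (Finset.sum_le_sum fun σ _ => ?_)
        rw [← smul_sub]
        rcases Int.units_eq_one_or (Equiv.Perm.sign σ) with h | h
        · simp [h]
        · simpa [h] using (norm_sub_rev _ _).le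
    _ ≤ ∑ _σ : Equiv.Perm ι, (Fintype.card ι * M ^ Fintype.card ι * η) := by
        refine Finset.sum_le_sum fun σ _ => ?_
        exact norm_prod_sub_prod_le Finset.univ _ _ hM (fun i _ => hA _ _) (fun i _ => hB _ _)
          (fun i _ => hAB _ _)
    _ = _ := by simp [Fintype.card_perm]

/-- Interpolation determinants of truncated power series are small. -/
theorem Matrix.norm_det_of_sum_le {ι : Type*} [Fintype ι] [DecidableEq ι] (c : ι → ℕ → ℂ)
    (x : ι → ℂ) {X E : ℝ} {M : ι → ℝ} (hX : 0 < X) (hE : 1 ≤ E) (hx : ∀ j, ‖x j‖ ≤ X)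
    (hc : ∀ i n, ‖c i n‖ * (2 * E * X) ^ n ≤ M i) (Q : ℕ) :
    ‖(Matrix.of fun i j => ∑ n ∈ Finset.range Q, c i n * x j ^ n).det‖ ≤
      (Fintype.card ι).factorial * 2 ^ Fintype.card ι * (∏ i, M i)
        / E ^ (Fintype.card ι).choose 2 := by
  have hM : ∀ i, 0 ≤ M i := fun i => le_trans (by positivity) (hc i 0)
  have hE0 : 0 < E := by linarith
  have hrow : (Matrix.of fun i j => ∑ n ∈ Finset.range Q, c i n * x j ^ n) =
      fun i => ∑ n : Fin Q, c i n • (fun j => x j ^ (n : ℕ)) := by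
    ext i j
    simp [Finset.sum_range]
  have hdet : (Matrix.of fun i j => ∑ n ∈ Finset.range Q, c i n * x j ^ n).det =
      ∑ p : ι → Fin Q, (∏ i, c i (p i)) • Matrix.det (Matrix.of fun i j => x j ^ (p i : ℕ)) := by
    rw [hrow]
    have h1 := (Matrix.detRowAlternating (n := ι) (R := ℂ)).toMultilinearMap.map_sum
      (fun i (n : Fin Q) => c i n • (fun j => x j ^ (n : ℕ)))
    refine h1.trans (Finset.sum_congr rfl fun p _ => ?_)
    exact (Matrix.detRowAlternating (n := ι) (R := ℂ)).toMultilinearMap.map_smul_univ _ _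
  rw [hdet]
  have hterm : ∀ p : ι → Fin Q,
      ‖(∏ i, c i (p i)) • Matrix.det (Matrix.of fun i j => x j ^ (p i : ℕ))‖ ≤
      ((Fintype.card ι).factorial * (∏ i, M i) / E ^ (Fintype.card ι).choose 2) *
        ∏ i, (1 / 2 : ℝ) ^ (p i : ℕ) := by
    intro p
    by_cases hp : Function.Injective p
    · have hdet : ‖Matrix.det (Matrix.of fun i j => x j ^ (p i : ℕ))‖ ≤
          (Fintype.card ι).factorial * ∏ i, X ^ (p i : ℕ) := by
        rw [← Matrix.det_transpose, Matrix.det_apply]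
        calc _ ≤ ∑ σ : Equiv.Perm ι, ∏ i, X ^ (p i : ℕ) := by
              refine (norm_sum_le _ _).trans (Finset.sum_le_sum fun σ _ => ?_)
              have : ‖∏ i, (Matrix.of fun i j => x j ^ (p i : ℕ))ᵀ (σ i) i‖ ≤
                  ∏ i, X ^ (p i : ℕ) := by
                rw [norm_prod]
                refine Finset.prod_le_prod (fun _ _ => norm_nonneg _) fun i _ => ?_
                simp only [transpose_apply, of_apply, norm_pow]
                exact pow_le_pow_left₀ (norm_nonneg _) (hx _) _
              rcases Int.units_eq_one_or (Equiv.Perm.sign σ) with h | h <;> simpa [h] using this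
          _ = _ := by simp [Fintype.card_perm]
      have hEp : E ^ (Fintype.card ι).choose 2 ≤ ∏ i, E ^ (p i : ℕ) := by
        rw [Finset.prod_pow_eq_pow_sum]
        exact pow_le_pow_right₀ hE (Finset.card_choose_two_le_sum_of_injective
          (p := fun i => (p i : ℕ)) (Fin.val_injective.comp hp))
      have hmain : (∏ i, ‖c i (p i)‖) * (∏ i, X ^ (p i : ℕ)) * ∏ i, E ^ (p i : ℕ) ≤
          (∏ i, M i) * ∏ i, (1 / 2 : ℝ) ^ (p i : ℕ) := by
        rw [← Finset.prod_mul_distrib, ← Finset.prod_mul_distrib, ← Finset.prod_mul_distrib]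
        refine Finset.prod_le_prod (fun _ _ => by positivity) fun i _ => ?_
        have := hc i (p i)
        rw [mul_pow, mul_pow] at this
        rw [one_div, inv_pow, ← div_eq_mul_inv, le_div_iff₀ (by positivity)]
        linarith
      rw [norm_smul, norm_prod]
      rw [div_mul_eq_mul_div, le_div_iff₀ (by positivity)]
      have hnn : 0 ≤ ∏ i, ‖c i (p i)‖ := Finset.prod_nonneg fun _ _ => norm_nonneg _
      calc _ ≤ (∏ i, ‖c i (p i)‖) * ((Fintype.card ι).factorial * ∏ i, X ^ (p i : ℕ)) *
            ∏ i, E ^ (p i : ℕ) := by gcongr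
        _ = (Fintype.card ι).factorial *
            ((∏ i, ‖c i (p i)‖) * (∏ i, X ^ (p i : ℕ)) * ∏ i, E ^ (p i : ℕ)) := by ring
        _ ≤ (Fintype.card ι).factorial * ((∏ i, M i) * ∏ i, (1 / 2 : ℝ) ^ (p i : ℕ)) := by
            gcongr
        _ = _ := by ring
    · rw [Function.Injective] at hp
      push Not at hp
      obtain ⟨i, j, hij, hne⟩ := hp
      rw [Matrix.det_zero_of_row_eq hne (by ext k; simp [hij]), smul_zero, norm_zero]
      have := Finset.prod_nonneg fun i (_ : i ∈ Finset.univ) => hM i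
      positivity
  calc _ ≤ ∑ p : ι → Fin Q, _ := (norm_sum_le _ _).trans (Finset.sum_le_sum fun p _ => hterm p)
    _ = ((Fintype.card ι).factorial * (∏ i, M i) / E ^ (Fintype.card ι).choose 2) *
        (∑ n : Fin Q, (1 / 2 : ℝ) ^ (n : ℕ)) ^ Fintype.card ι := by
        rw [← Finset.mul_sum]
        congr 1
        have h := Finset.prod_univ_sum (fun _ : ι => (Finset.univ : Finset (Fin Q)))
          (fun _ n => (1 / 2 : ℝ) ^ (n : ℕ))
        rw [Fintype.piFinset_univ] at h
        rw [← h, Finset.prod_const, Finset.card_univ]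
    _ ≤ ((Fintype.card ι).factorial * (∏ i, M i) / E ^ (Fintype.card ι).choose 2) *
        2 ^ Fintype.card ι := by
        have hnn := Finset.prod_nonneg fun i (_ : i ∈ Finset.univ) => hM i
        gcongr
        rw [← Finset.sum_range (fun n => (1 / 2 : ℝ) ^ n)]
        exact sum_geometric_two_le Q
    _ = _ := by ring

/-- Interpolation determinants of power series are small. -/
theorem Matrix.norm_det_of_hasSum_le {ι : Type*} [Fintype ι] [DecidableEq ι] (c : ι → ℕ → ℂ)
    (x : ι → ℂ) {A : Matrix ι ι ℂ} {X E : ℝ} {M : ι → ℝ} (hX : 0 < X) (hE : 1 ≤ E)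
    (hx : ∀ j, ‖x j‖ ≤ X) (hc : ∀ i n, ‖c i n‖ * (2 * E * X) ^ n ≤ M i)
    (hA : ∀ i j, HasSum (fun n => c i n * x j ^ n) (A i j)) :
    ‖A.det‖ ≤ (Fintype.card ι).factorial * 2 ^ Fintype.card ι * (∏ i, M i)
        / E ^ (Fintype.card ι).choose 2 := by
  have hlim : Filter.Tendsto (fun Q => Matrix.of fun i j => ∑ n ∈ Finset.range Q, c i n * x j ^ n)
      Filter.atTop (nhds A) :=
    tendsto_pi_nhds.2 fun i => tendsto_pi_nhds.2 fun j => (hA i j).tendsto_sum_nat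
  have hcont : Continuous fun B : Matrix ι ι ℂ => ‖B.det‖ := by fun_prop
  exact le_of_tendsto ((hcont.tendsto A).comp hlim)
    (Filter.Eventually.of_forall fun Q => norm_det_of_sum_le c x hX hE hx hc Q)

theorem Polynomial.coeff_prod_of_natDegree_le' {R ι : Type*} [CommSemiring R] (s : Finset ι)
    (f : ι → Polynomial R) (d : ι → ℕ) (h : ∀ i ∈ s, (f i).natDegree ≤ d i) :
    (∏ i ∈ s, f i).coeff (∑ i ∈ s, d i) = ∏ i ∈ s, (f i).coeff (d i) := by
  classical
  induction s using Finset.induction_on with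
  | empty => simp
  | insert a s ha ih =>
    rw [Finset.prod_insert ha, Finset.prod_insert ha, Finset.sum_insert ha,
      Polynomial.coeff_mul_add_eq_of_natDegree_le (h a (Finset.mem_insert_self _ _)),
      ih fun i hi => h i (Finset.mem_insert_of_mem hi)]
    exact (Polynomial.natDegree_prod_le _ _).trans
      (Finset.sum_le_sum fun i hi => h i (Finset.mem_insert_of_mem hi))

/-- Zero estimate: a polynomial in `X, Y` of degree `< K` in `X` and `< L` in `Y` that vanishes at
the points `(b r - a s, α ^ r β ^ s)` for sufficiently many `r, s` is zero. -/
theorem zero_estimate {F : Type*} [Field F] [CharZero F] {K L R S : ℕ}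
    {P : Fin L → Polynomial F} (hdeg : ∀ j, (P j).natDegree < K) {α β : F}
    (hα : ∀ n : ℕ, 0 < n → α ^ n ≠ 1) (hα0 : α ≠ 0) (hβ0 : β ≠ 0) {a b : ℤ}
    (hinj : Function.Injective fun t : Fin R × Fin S => b * (t.1 : ℤ) - a * (t.2 : ℤ))
    (hcard : K * L ≤ R * S)
    (hzero : ∀ r s : ℕ, r < L + R → s < S →
      ∑ j, (P j).eval ((b * r - a * s : ℤ) : F) * (α ^ r * β ^ s) ^ (j : ℕ) = 0) (j : Fin L) :
    P j = 0 := by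
  classical
  by_contra hj
  let Q : Fin L → Polynomial F := fun j => if P j = 0 then 1 else P j
  have hQ0 : ∀ j, Q j ≠ 0 := fun j => by by_cases h : P j = 0 <;> simp [Q, h]
  have hQdeg : ∀ j, (Q j).natDegree + 1 ≤ K := fun j => by
    have := hdeg j
    by_cases h : P j = 0
    · simp only [Q, h, if_true, Polynomial.natDegree_one]; lia
    · simp only [Q, h, if_false]; lia
  let D := ∑ j, (Q j).natDegree
  have hD : D < K * L := by
    have : ∑ j : Fin L, ((Q j).natDegree + 1) ≤ ∑ j : Fin L, K :=
      Finset.sum_le_sum fun j _ => hQdeg j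
    rw [Finset.sum_add_distrib] at this
    simp only [Finset.sum_const, Finset.card_univ, Fintype.card_fin, smul_eq_mul, mul_one] at this
    have hL := j.pos
    rw [mul_comm K]
    lia
  let A : Matrix (Fin L) (Fin L) (Polynomial F) := Matrix.of fun ρ j =>
    Polynomial.taylor (b * (ρ : ℕ) : F) (Q j) * Polynomial.C ((α ^ (j : ℕ)) ^ (ρ : ℕ))
  have hAdeg : ∀ ρ j, (A ρ j).natDegree ≤ (Q j).natDegree := fun ρ j => by
    refine (Polynomial.natDegree_mul_C_le _ _).trans ?_
    exact (Polynomial.natDegree_taylor _ _).le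
  have hdet_deg : A.det.natDegree ≤ D := by
    rw [Matrix.det_apply]
    refine Polynomial.natDegree_sum_le_of_forall_le _ _ fun σ _ => ?_
    refine (Polynomial.natDegree_smul_le _ _).trans ?_
    exact (Polynomial.natDegree_prod_le _ _).trans (Finset.sum_le_sum fun i _ => hAdeg _ _)
  have hdet_ne : A.det ≠ 0 := by
    have hcoeff : A.det.coeff D = Matrix.det (Matrix.of fun ρ j : Fin L =>
        (Q j).leadingCoeff * (Matrix.vandermonde fun j : Fin L => α ^ (j : ℕ))ᵀ ρ j) := by
      rw [Matrix.det_apply', Matrix.det_apply', Polynomial.finsetSum_coeff]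
      refine Finset.sum_congr rfl fun σ _ => ?_
      have : ((Equiv.Perm.sign σ : ℤ) : Polynomial F) = Polynomial.C ((Equiv.Perm.sign σ : ℤ) : F) := by
        simp
      rw [this, Polynomial.coeff_C_mul,
        Polynomial.coeff_prod_of_natDegree_le' _ _ _ fun i _ => hAdeg _ _]
      congr 1
      refine Finset.prod_congr rfl fun i _ => ?_
      have htaylor := Polynomial.coeff_taylor_natDegree (b * (σ i : ℕ) : F) (Q i)
      simp only [A, Matrix.of_apply, Polynomial.coeff_mul_C, Matrix.transpose_apply,
        Matrix.vandermonde_apply]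
      rw [← htaylor]
    intro h0
    rw [h0, Polynomial.coeff_zero, Matrix.det_mul_row] at hcoeff
    refine mul_ne_zero (Finset.prod_ne_zero_iff.2 fun j _ =>
      Polynomial.leadingCoeff_ne_zero.2 (hQ0 j)) ?_ hcoeff.symm
    rw [Matrix.det_transpose, Matrix.det_vandermonde_ne_zero_iff]
    have key : ∀ i k : ℕ, i < k → α ^ i ≠ α ^ k := fun i k hik h => by
      refine hα (k - i) (by lia) ?_
      have : α ^ k = α ^ i * α ^ (k - i) := by rw [← pow_add]; congr 1; lia
      rw [this] at h
      exact (mul_right_eq_self₀.1 h.symm).resolve_right (pow_ne_zero _ hα0)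
    intro i k hik
    rcases lt_trichotomy (i : ℕ) k with h | h | h
    · exact absurd hik (key _ _ h)
    · exact Fin.ext h
    · exact absurd hik.symm (key _ _ h)
  refine hdet_ne (Polynomial.eq_zero_of_natDegree_lt_card_of_eval_eq_zero A.det
    (f := fun t : Fin R × Fin S => ((b * (t.1 : ℕ) - a * (t.2 : ℕ) : ℤ) : F))
    (fun t t' h => hinj (Int.cast_injective h)) (fun t => ?_) ?_)
  · have hmap : A.det.eval ((b * (t.1 : ℕ) - a * (t.2 : ℕ) : ℤ) : F) =
        (A.map (Polynomial.eval ((b * (t.1 : ℕ) - a * (t.2 : ℕ) : ℤ) : F))).det :=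
      (Polynomial.evalRingHom _).map_det A
    rw [hmap]
    refine Matrix.exists_mulVec_eq_zero_iff.1
      ⟨fun j => if P j = 0 then 0 else (α ^ (t.1 : ℕ) * β ^ (t.2 : ℕ)) ^ (j : ℕ), ?_, ?_⟩
    · intro h
      have := congrFun h j
      simp [hj, hα0, hβ0] at this
    · ext ρ
      have := hzero (ρ + t.1) t.2 (by lia) t.2.2
      rw [Pi.zero_apply]
      refine Eq.trans ?_ this
      simp only [Matrix.mulVec, dotProduct]
      refine Finset.sum_congr rfl fun k _ => ?_
      by_cases h : P k = 0
      · simp [h]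
      · simp only [Matrix.map_apply, A, Matrix.of_apply, Q, h, if_false, Polynomial.eval_mul,
          Polynomial.taylor_eval, Polynomial.eval_C]
        have harg : ((b * (t.1 : ℕ) - a * (t.2 : ℕ) : ℤ) : F) + b * (ρ : ℕ) =
            ((b * (ρ + t.1 : ℕ) - a * (t.2 : ℕ) : ℤ) : F) := by push_cast; ring
        rw [harg]
        ring
  · simp only [Fintype.card_prod, Fintype.card_fin]
    lia

/-- A family of columns spanning `F ^ ι` contains a nonvanishing minor. -/
theorem exists_submatrix_det_ne_zero {F ι τ : Type*} [Field F] [Fintype ι] [DecidableEq ι]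
    (A : Matrix ι τ F) (h : ∀ p : ι → F, (∀ t, ∑ i, p i * A i t = 0) → p = 0) :
    ∃ f : ι → τ, (A.submatrix id f).det ≠ 0 := by
  obtain ⟨κ, f, -, hspan, hli⟩ := exists_linearIndependent' F (fun t => fun i => A i t)
  have htop : Submodule.span F (Set.range fun t => fun i => A i t) = ⊤ := by
    by_contra hne
    obtain ⟨φ, hφ, hle⟩ := Submodule.exists_le_ker_of_lt_top _ (lt_top_iff_ne_top.2 hne)
    refine hφ ?_
    have hp := h (fun i => φ (Pi.single i 1)) fun t => by
      have : φ (fun i => A i t) = 0 := hle (Submodule.subset_span ⟨t, rfl⟩)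
      rw [← this, LinearMap.pi_apply_eq_sum_univ]
      refine Finset.sum_congr rfl fun i _ => ?_
      rw [smul_eq_mul, mul_comm]
      congr 2
      ext k
      simp [Pi.single_apply, eq_comm]
    refine LinearMap.pi_ext' fun i => ?_
    ext
    simpa using congrFun hp i
  rw [htop] at hspan
  let B := Module.Basis.mk hli hspan.ge
  let e : ι ≃ κ := (Pi.basisFun F ι).indexEquiv B
  refine ⟨f ∘ e, ?_⟩
  have hli' : LinearIndependent F (A.submatrix id (f ∘ e)).col := hli.comp e e.injective
  rw [Matrix.linearIndependent_cols_iff_isUnit, Matrix.isUnit_iff_isUnit_det] at hli'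
  exact hli'.ne_zero

theorem NumberField.one_le_prod_norm_embedding {F : Type*} [Field F] [NumberField F] {x : F}
    (hx : IsIntegral ℤ x) (hx0 : x ≠ 0) : 1 ≤ ∏ τ : F →ₐ[ℚ] ℂ, ‖τ x‖ := by
  obtain ⟨n, hn⟩ := IsIntegrallyClosed.isIntegral_iff.1 (Algebra.isIntegral_norm ℚ hx)
  have hn0 : n ≠ 0 := by
    rintro rfl
    simp only [map_zero] at hn
    exact hx0 (Algebra.norm_eq_zero_iff.1 hn.symm)
  have hprod := Algebra.norm_eq_prod_embeddings ℚ ℂ x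
  rw [← hn] at hprod
  rw [← norm_prod, ← hprod]
  simp only [algebraMap_int_eq, eq_intCast, eq_ratCast, Rat.cast_intCast, Complex.norm_intCast]
  exact_mod_cast Int.one_le_abs hn0

/-- Liouville's inequality for a nonzero algebraic integer. -/
theorem NumberField.one_le_norm_embedding_mul_pow {F : Type*} [Field F] [NumberField F]
    (σ : F →+* ℂ) {x : F} (hx : IsIntegral ℤ x) (hx0 : x ≠ 0) {H : ℝ} (hH : 1 ≤ H)
    (hle : ∀ τ : F →+* ℂ, ‖τ x‖ ≤ H) : 1 ≤ ‖σ x‖ * H ^ Module.finrank ℚ F := by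
  classical
  have h1 := NumberField.one_le_prod_norm_embedding hx hx0
  let σ' : F →ₐ[ℚ] ℂ := σ.toRatAlgHom
  rw [← Finset.mul_prod_erase Finset.univ _ (Finset.mem_univ σ')] at h1
  refine h1.trans ?_
  have hσ : σ' x = σ x := rfl
  rw [hσ]
  gcongr
  calc _ ≤ ∏ τ ∈ Finset.univ.erase σ', H :=
        Finset.prod_le_prod (fun _ _ => norm_nonneg _) fun τ _ => hle τ.toRingHom
    _ = H ^ (Finset.univ.erase σ').card := Finset.prod_const _
    _ ≤ _ := by
        refine pow_le_pow_right₀ hH ((Finset.card_le_card (Finset.erase_subset _ _)).trans ?_)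
        rw [Finset.card_univ, AlgHom.card]

theorem pow_le_exp_mul_pow_six {x c T : ℝ} {m k : ℕ} (hT : 1 ≤ T) (hc : 0 ≤ c) (hx0 : 0 ≤ x)
    (hx : x ≤ c * T ^ m) (hk : (k : ℝ) ≤ T ^ 4) : x ^ k ≤ Real.exp ((c + m) * T ^ 6) := by
  have hT' : T ≤ Real.exp T := by linarith [Real.add_one_le_exp T]
  have h1 : x ≤ Real.exp ((c + m) * T) := by
    calc x ≤ c * T ^ m := hx
      _ ≤ Real.exp c * Real.exp T ^ m := by
          gcongr
          linarith [Real.add_one_le_exp c]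
      _ = Real.exp (c + m * T) := by rw [Real.exp_add, Real.exp_nat_mul]
      _ ≤ _ := by
          gcongr
          nlinarith
  calc x ^ k ≤ Real.exp ((c + m) * T) ^ k := by gcongr
    _ = Real.exp (k * ((c + m) * T)) := (Real.exp_nat_mul _ _).symm
    _ ≤ _ := by
        refine Real.exp_le_exp.2 ?_
        have h0 : 0 ≤ (c + m) * T := by positivity
        have h56 : T ^ 5 ≤ T ^ 6 := pow_le_pow_right₀ hT (by norm_num)
        calc (k : ℝ) * ((c + m) * T) ≤ T ^ 4 * ((c + m) * T) := by gcongr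
          _ = (c + m) * T ^ 5 := by ring
          _ ≤ _ := by gcongr

/-- Taylor coefficients of `(b x) ^ k * exp (μ x)`. -/
noncomputable def monomialExpCoeff (b μ : ℂ) (k n : ℕ) : ℂ :=
  if n < k then 0 else b ^ k * μ ^ (n - k) / (n - k).factorial

theorem hasSum_monomialExpCoeff (b μ x : ℂ) (k : ℕ) :
    HasSum (fun n => monomialExpCoeff b μ k n * x ^ n) ((b * x) ^ k * Complex.exp (μ * x)) := by
  have hinj : Function.Injective fun n : ℕ => n + k := add_left_injective k
  rw [← hinj.hasSum_iff]
  · have := (NormedSpace.expSeries_div_hasSum_exp (μ * x)).mul_left ((b * x) ^ k)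
    rw [← Complex.exp_eq_exp_ℂ] at this
    refine this.congr_fun ?_
    intro n
    simp only [Function.comp, monomialExpCoeff, Nat.add_sub_cancel]
    rw [if_neg (by lia)]
    ring
  · intro n hn
    rw [monomialExpCoeff, if_pos, zero_mul]
    by_contra h
    exact hn ⟨n - k, by simp only; lia⟩

theorem norm_monomialExpCoeff_mul_pow_le (b μ : ℂ) (k n : ℕ) {ρ : ℝ} (hρ : 0 ≤ ρ) :
    ‖monomialExpCoeff b μ k n‖ * ρ ^ n ≤ (‖b‖ * ρ) ^ k * Real.exp (‖μ‖ * ρ) := by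
  rw [monomialExpCoeff]
  split_ifs with h
  · simp only [norm_zero, zero_mul]
    positivity
  · obtain ⟨m, rfl⟩ := Nat.exists_eq_add_of_le (not_lt.1 h)
    have := Real.pow_div_factorial_le_exp (‖μ‖ * ρ) (by positivity) m
    simp only [Nat.add_sub_cancel_left, norm_div, norm_mul, norm_pow, Complex.norm_natCast]
    calc ‖b‖ ^ k * ‖μ‖ ^ m / m.factorial * ρ ^ (k + m)
        = (‖b‖ * ρ) ^ k * ((‖μ‖ * ρ) ^ m / m.factorial) := by ring
      _ ≤ _ := by gcongr

set_option maxHeartbeats 4000000 in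
/-- Interpolation determinants for the functions `x ^ k * exp (l * λ₁ * x)` at the points
`r - (a / b) * s`: the key inequality of the Gelfond–Schneider method. -/
theorem one_le_exp_mul_of_interpolation {F : Type*} [Field F] [NumberField F] (σ : F →+* ℂ)
    {α β : F} (hα : IsIntegral ℤ α) (hβ : IsIntegral ℤ β) (hα1 : ∀ n : ℕ, 0 < n → α ^ n ≠ 1)
    {lam₁ lam₂ : ℂ} (h₁ : σ α = Complex.exp lam₁) (h₂ : σ β = Complex.exp lam₂) {C₁ : ℝ}
    (hC₁ : 0 ≤ C₁) :
    ∃ C : ℝ, 0 < C ∧ ∀ T : ℕ, 1 ≤ T → ∀ a b : ℤ, IsCoprime a b → (T : ℝ) ^ 5 ≤ |(b : ℝ)| →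
      |(a : ℝ)| ≤ C₁ * |(b : ℝ)| → |(b : ℝ)| ≤ (T : ℝ) ^ 14 → ‖a * lam₁ + b * lam₂‖ ≤ 1 →
      1 ≤ Real.exp (C * (T : ℝ) ^ 12) *
        (1 / (T : ℝ) ^ (T ^ 6).choose 2 + ‖a * lam₁ + b * lam₂‖) := by
  classical
  obtain ⟨h, hh0, hhα, hhβ⟩ : ∃ h : ℝ, 0 ≤ h ∧ (∀ τ : F →+* ℂ, ‖τ α‖ ≤ Real.exp h) ∧
      ∀ τ : F →+* ℂ, ‖τ β‖ ≤ Real.exp h := by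
    refine ⟨∑ τ : F →+* ℂ, (‖τ α‖ + ‖τ β‖), Finset.sum_nonneg fun _ _ => by positivity,
      fun τ => ?_, fun τ => ?_⟩ <;>
    · have := Finset.single_le_sum (f := fun τ : F →+* ℂ => ‖τ α‖ + ‖τ β‖)
        (fun _ _ => by positivity) (Finset.mem_univ τ)
      have h3 := Real.add_one_le_exp (∑ τ : F →+* ℂ, (‖τ α‖ + ‖τ β‖))
      have h4 := norm_nonneg (τ α)
      have h5 := norm_nonneg (τ β)
      linarith
  set D : ℝ := 2 + C₁ with hD
  set d := Module.finrank ℚ F with hd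
  set c : ℝ := 2 * D + 18 + 2 * D * ‖lam₁‖ + 3 * h with hc
  have hD0 : 0 ≤ D := by positivity
  have hDl : 0 ≤ D * ‖lam₁‖ := by positivity
  have hc0 : 0 < c := by positivity
  refine ⟨d * (6 + c) + (15 + 2 * c), by positivity, ?_⟩
  intro T hT a b hab hb5 hab1 hb14 hΛ
  set Λ := (a : ℂ) * lam₁ + b * lam₂ with hΛdef
  have hT1 : (1 : ℝ) ≤ T := by exact_mod_cast hT
  have hT0 : (0 : ℝ) < T := by linarith
  have hTexp : (T : ℝ) ≤ Real.exp T := by linarith [Real.add_one_le_exp (T : ℝ)]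
  have hTpow : ∀ {m n : ℕ}, m ≤ n → (T : ℝ) ^ m ≤ (T : ℝ) ^ n := fun h => pow_le_pow_right₀ hT1 h
  have hbpos : 0 < |(b : ℝ)| := lt_of_lt_of_le (by positivity) hb5
  have hb0 : b ≠ 0 := by
    rintro rfl
    simp at hbpos
  have hbC : (b : ℂ) ≠ 0 := by exact_mod_cast hb0
  have hα0 : α ≠ 0 := by
    rintro rfl
    rw [map_zero] at h₁
    exact Complex.exp_ne_zero _ h₁.symm
  have hβ0 : β ≠ 0 := by
    rintro rfl
    rw [map_zero] at h₂
    exact Complex.exp_ne_zero _ h₂.symm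
  -- the interpolation matrix over `F`
  let A : Matrix (Fin (T ^ 4) × Fin (T ^ 2)) (Fin (T ^ 2 + T ^ 3) × Fin (T ^ 3)) F :=
    Matrix.of fun i t => ((b * (t.1 : ℕ) - a * (t.2 : ℕ) : ℤ) : F) ^ (i.1 : ℕ) *
      (α ^ (t.1 : ℕ) * β ^ (t.2 : ℕ)) ^ (i.2 : ℕ)
  have hinj : Function.Injective fun t : Fin (T ^ 3) × Fin (T ^ 3) =>
      b * (t.1 : ℤ) - a * (t.2 : ℤ) := by
    rintro ⟨r, s⟩ ⟨r', s'⟩ hrs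
    simp only at hrs
    have hdvd : b ∣ a * ((s : ℤ) - s') := ⟨(r : ℤ) - r', by linarith⟩
    have hdvd' := hab.symm.dvd_of_dvd_mul_left hdvd
    have hbT : (T : ℤ) ^ 3 ≤ |b| := by
      have : (T : ℝ) ^ 3 ≤ |(b : ℝ)| := (hTpow (by norm_num)).trans hb5
      exact_mod_cast this
    have hs : (s : ℤ) - s' = 0 := by
      refine Int.eq_zero_of_abs_lt_dvd ((abs_dvd b _).2 hdvd') (lt_of_lt_of_le ?_ hbT)
      have h1 : ((s : ℕ) : ℤ) < (T : ℤ) ^ 3 := by exact_mod_cast s.2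
      have h2 : ((s' : ℕ) : ℤ) < (T : ℤ) ^ 3 := by exact_mod_cast s'.2
      rw [abs_lt]
      constructor <;> linarith [Int.natCast_nonneg (s : ℕ), Int.natCast_nonneg (s' : ℕ)]
    have hs' : (s : ℤ) = s' := by linarith
    rw [hs'] at hrs
    have hr : (r : ℤ) = r' := mul_left_cancel₀ hb0 (by linarith)
    ext
    · exact_mod_cast hr
    · exact_mod_cast hs'
  obtain ⟨f, hf⟩ := exists_submatrix_det_ne_zero A (by
    intro p hp
    let P : Fin (T ^ 2) → Polynomial F := fun l =>
      ∑ k : Fin (T ^ 4), Polynomial.C (p (k, l)) * Polynomial.X ^ (k : ℕ)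
    have hP : ∀ l, P l = 0 := by
      refine zero_estimate (K := T ^ 4) (R := T ^ 3) (S := T ^ 3) (fun l => ?_) hα1 hα0 hβ0 hinj
        (le_of_eq (by ring)) fun r s hr hs => ?_
      · refine lt_of_le_of_lt (Polynomial.natDegree_sum_le_of_forall_le (n := T ^ 4 - 1) _ _
          fun k _ => ?_) (Nat.sub_lt (by positivity) one_pos)
        exact (Polynomial.natDegree_C_mul_X_pow_le _ _).trans (by lia)
      · rw [← hp (⟨r, hr⟩, ⟨s, hs⟩), Fintype.sum_prod_type_right]
        refine Finset.sum_congr rfl fun l _ => ?_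
        simp only [P, Polynomial.eval_finsetSum, Polynomial.eval_mul, Polynomial.eval_C,
          Polynomial.eval_pow, Polynomial.eval_X, Finset.sum_mul, A, Matrix.of_apply, mul_assoc]
    ext ⟨k, l⟩
    have := congrArg (fun q => Polynomial.coeff q (k : ℕ)) (hP l)
    simpa [P, Polynomial.coeff_C_mul, Polynomial.coeff_X_pow, Fin.val_inj] using this)
  set B := A.submatrix id f with hB
  have hBint : IsIntegral ℤ B.det := by
    refine IsIntegral.det fun i t => ?_
    simp only [hB, A, Matrix.submatrix_apply, Matrix.of_apply]
    refine IsIntegral.mul (IsIntegral.pow ?_ _) (((hα.pow _).mul (hβ.pow _)).pow _)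
    exact isIntegral_algebraMap (x := (b * ((f t).1 : ℕ) - a * ((f t).2 : ℕ) : ℤ))
  -- sizes
  set M : ℝ := Real.exp (c * (T : ℝ) ^ 6) with hM
  have hM1 : 1 ≤ M := Real.one_le_exp (by positivity)
  have hcardι : Fintype.card (Fin (T ^ 4) × Fin (T ^ 2)) = T ^ 6 := by
    simp only [Fintype.card_prod, Fintype.card_fin]
    ring
  have hk : ∀ i : Fin (T ^ 4) × Fin (T ^ 2), ((i.1 : ℕ) : ℝ) ≤ (T : ℝ) ^ 4 := fun i => by
    exact_mod_cast i.1.2.le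
  have hl : ∀ i : Fin (T ^ 4) × Fin (T ^ 2), ((i.2 : ℕ) : ℝ) ≤ (T : ℝ) ^ 2 := fun i => by
    exact_mod_cast i.2.2.le
  have hr : ∀ j, (((f j).1 : ℕ) : ℝ) ≤ 2 * (T : ℝ) ^ 3 := fun j => by
    have h1 : (((f j).1 : ℕ) : ℝ) ≤ (T : ℝ) ^ 2 + (T : ℝ) ^ 3 := by exact_mod_cast (f j).1.2.le
    linarith [hTpow (show 2 ≤ 3 by norm_num)]
  have hs : ∀ j, (((f j).2 : ℕ) : ℝ) ≤ (T : ℝ) ^ 3 := fun j => by exact_mod_cast (f j).2.2.le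
  set x : Fin (T ^ 4) × Fin (T ^ 2) → ℂ := fun j => ((f j).1 : ℕ) - (a / b : ℂ) * ((f j).2 : ℕ)
    with hx
  have hab' : ‖(a / b : ℂ)‖ ≤ C₁ := by
    rw [norm_div, Complex.norm_intCast, Complex.norm_intCast, div_le_iff₀ hbpos]
    exact hab1
  have hxle : ∀ j, ‖x j‖ ≤ D * (T : ℝ) ^ 3 := fun j => by
    calc ‖x j‖ ≤ ‖(((f j).1 : ℕ) : ℂ)‖ + ‖(a / b : ℂ) * ((f j).2 : ℕ)‖ := norm_sub_le _ _
      _ = ((f j).1 : ℕ) + ‖(a / b : ℂ)‖ * ((f j).2 : ℕ) := by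
          rw [norm_mul, Complex.norm_natCast, Complex.norm_natCast]
      _ ≤ 2 * (T : ℝ) ^ 3 + C₁ * (T : ℝ) ^ 3 := by
          gcongr
          · exact hr j
          · exact hs j
      _ = _ := by rw [hD]; ring
  have hw : ∀ j, ((b * ((f j).1 : ℕ) - a * ((f j).2 : ℕ) : ℤ) : ℂ) = b * x j := fun j => by
    simp only [hx]
    push_cast
    field_simp
  have hwle : ∀ j, ‖b * x j‖ ≤ D * (T : ℝ) ^ 17 := fun j => by
    rw [norm_mul, Complex.norm_intCast]
    calc _ ≤ (T : ℝ) ^ 14 * (D * (T : ℝ) ^ 3) := by gcongr; exact hxle j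
      _ = _ := by ring
  have hwpow : ∀ i : Fin (T ^ 4) × Fin (T ^ 2), ∀ j, ‖b * x j‖ ^ (i.1 : ℕ) ≤ Real.exp ((D + 17) * (T : ℝ) ^ 6) := fun i j => by
    exact_mod_cast pow_le_exp_mul_pow_six hT1 hD0 (norm_nonneg _) (hwle j) (hk i)
  have hBle : ∀ τ : F →+* ℂ, ∀ i j, ‖τ (B i j)‖ ≤ M := fun τ i j => by
    have hαβ : ‖τ (α ^ ((f j).1 : ℕ) * β ^ ((f j).2 : ℕ))‖ ≤ Real.exp (3 * h * (T : ℝ) ^ 3) := by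
      rw [map_mul, map_pow, map_pow, norm_mul, norm_pow, norm_pow]
      calc _ ≤ Real.exp h ^ ((f j).1 : ℕ) * Real.exp h ^ ((f j).2 : ℕ) := by
            gcongr
            · exact hhα τ
            · exact hhβ τ
        _ = Real.exp ((((f j).1 : ℕ) + ((f j).2 : ℕ)) * h) := by
            rw [← Real.exp_nat_mul, ← Real.exp_nat_mul, ← Real.exp_add]
            ring_nf
        _ ≤ _ := by
            refine Real.exp_le_exp.2 ?_
            nlinarith [hr j, hs j]
    simp only [hB, A, Matrix.submatrix_apply, Matrix.of_apply, id]
    rw [map_mul, map_pow, map_intCast, hw, norm_mul, norm_pow, map_pow, norm_pow]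
    calc _ ≤ Real.exp ((D + 17) * (T : ℝ) ^ 6) * Real.exp (3 * h * (T : ℝ) ^ 3) ^ (i.2 : ℕ) := by
          gcongr
          exact hwpow i j
      _ = Real.exp ((D + 17) * (T : ℝ) ^ 6 + (i.2 : ℕ) * (3 * h * (T : ℝ) ^ 3)) := by
          rw [← Real.exp_nat_mul, ← Real.exp_add]
      _ ≤ _ := by
          refine Real.exp_le_exp.2 ?_
          have h1 : ((i.2 : ℕ) : ℝ) * (3 * h * (T : ℝ) ^ 3) ≤ (T : ℝ) ^ 2 * (3 * h * (T : ℝ) ^ 3) := by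
            gcongr
            exact hl i
          have h2 : (T : ℝ) ^ 2 * (3 * h * (T : ℝ) ^ 3) = 3 * h * (T : ℝ) ^ 5 := by ring
          have h3 : 3 * h * (T : ℝ) ^ 5 ≤ 3 * h * (T : ℝ) ^ 6 :=
            mul_le_mul_of_nonneg_left (hTpow (by norm_num)) (by positivity)
          have h4 : 0 ≤ (D + 1 + 2 * (D * ‖lam₁‖)) * (T : ℝ) ^ 6 := by positivity
          rw [hc]
          nlinarith
  have hfact : ((T ^ 6).factorial : ℝ) ≤ Real.exp (6 * (T : ℝ) ^ 12) := by
    calc ((T ^ 6).factorial : ℝ) ≤ ((T ^ 6 : ℕ) : ℝ) ^ (T ^ 6) := by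
          exact_mod_cast Nat.factorial_le_pow _
      _ ≤ (Real.exp T ^ 6) ^ (T ^ 6) := by
          push_cast
          gcongr
      _ = Real.exp (6 * (T : ℝ) ^ 7) := by
          rw [← pow_mul, ← Real.exp_nat_mul]
          push_cast
          ring_nf
      _ ≤ _ := by
          refine Real.exp_le_exp.2 ?_
          linarith [hTpow (show 7 ≤ 12 by norm_num)]
  have hMpow : M ^ (T ^ 6) = Real.exp (c * (T : ℝ) ^ 12) := by
    rw [hM, ← Real.exp_nat_mul]
    push_cast
    ring_nf
  have hnormdet : ∀ τ : F →+* ℂ, ‖τ B.det‖ ≤ Real.exp ((6 + c) * (T : ℝ) ^ 12) := fun τ => by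
    rw [τ.map_det]
    refine (Matrix.norm_det_le (M := M) fun i j => hBle τ i j).trans ?_
    rw [hcardι, hMpow, show (6 + c) * (T : ℝ) ^ 12 = 6 * (T : ℝ) ^ 12 + c * (T : ℝ) ^ 12 by ring,
      Real.exp_add]
    exact mul_le_mul_of_nonneg_right hfact (Real.exp_pos _).le
  have hLiouville := NumberField.one_le_norm_embedding_mul_pow σ hBint hf
    (Real.one_le_exp (by positivity)) hnormdet
  -- the analytic upper bound
  let G : Matrix (Fin (T ^ 4) × Fin (T ^ 2)) (Fin (T ^ 4) × Fin (T ^ 2)) ℂ :=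
    Matrix.of fun i j => (b * x j) ^ (i.1 : ℕ) * Complex.exp ((i.2 : ℕ) * lam₁ * x j)
  have hexpG : ∀ (i : Fin (T ^ 4) × Fin (T ^ 2)) {ρ : ℝ}, 0 ≤ ρ → ρ ≤ 2 * D * (T : ℝ) ^ 4 →
      Real.exp (‖((i.2 : ℕ) * lam₁ : ℂ)‖ * ρ) ≤ Real.exp (2 * D * ‖lam₁‖ * (T : ℝ) ^ 6) := by
    intro i ρ hρ0 hρ
    refine Real.exp_le_exp.2 ?_
    rw [norm_mul, Complex.norm_natCast]
    calc _ ≤ ((T : ℝ) ^ 2 * ‖lam₁‖) * (2 * D * (T : ℝ) ^ 4) := by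
          gcongr
          exact hl i
      _ = _ := by ring
  have hGle : ∀ i j, ‖G i j‖ ≤ M := fun i j => by
    simp only [G, Matrix.of_apply]
    rw [norm_mul, norm_pow, hM, hc]
    have h1 : ‖Complex.exp ((i.2 : ℕ) * lam₁ * x j)‖ ≤
        Real.exp (2 * D * ‖lam₁‖ * (T : ℝ) ^ 6) := by
      refine (Complex.norm_exp_le_exp_norm _).trans ?_
      rw [norm_mul]
      refine hexpG i (norm_nonneg _) ((hxle j).trans ?_)
      have := hTpow (show 3 ≤ 4 by norm_num)
      have h3 : D * (T : ℝ) ^ 3 ≤ D * (T : ℝ) ^ 4 := by gcongr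
      have h4 : 0 ≤ D * (T : ℝ) ^ 4 := by positivity
      linarith
    calc _ ≤ Real.exp ((D + 17) * (T : ℝ) ^ 6) * Real.exp (2 * D * ‖lam₁‖ * (T : ℝ) ^ 6) := by
          gcongr
          exact hwpow i j
      _ = Real.exp ((D + 17) * (T : ℝ) ^ 6 + 2 * D * ‖lam₁‖ * (T : ℝ) ^ 6) := by
          rw [← Real.exp_add]
      _ ≤ _ := by
          refine Real.exp_le_exp.2 ?_
          have : 0 ≤ (D + 1 + 3 * h) * (T : ℝ) ^ 6 := by positivity
          nlinarith
  have hGdet : ‖G.det‖ ≤ Real.exp ((7 + c) * (T : ℝ) ^ 12) * (1 / (T : ℝ) ^ (T ^ 6).choose 2) := by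
    have := Matrix.norm_det_of_hasSum_le
      (fun i : Fin (T ^ 4) × Fin (T ^ 2) => monomialExpCoeff b ((i.2 : ℕ) * lam₁) (i.1 : ℕ)) x
      (A := G) (X := D * (T : ℝ) ^ 3) (E := T) (M := fun _ => M) (by positivity) hT1 hxle
      (fun i n => by
        refine (norm_monomialExpCoeff_mul_pow_le _ _ _ _ (by positivity)).trans ?_
        have h1 : (‖(b : ℂ)‖ * (2 * T * (D * (T : ℝ) ^ 3))) ^ (i.1 : ℕ) ≤
            Real.exp ((2 * D + 18) * (T : ℝ) ^ 6) := by
          refine (pow_le_exp_mul_pow_six (m := 18) hT1 (c := 2 * D) (by positivity)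
            (by positivity) ?_ (hk i)).trans (le_of_eq (by norm_num))
          rw [Complex.norm_intCast]
          calc _ ≤ (T : ℝ) ^ 14 * (2 * T * (D * (T : ℝ) ^ 3)) := by gcongr
            _ = _ := by ring
        calc _ ≤ Real.exp ((2 * D + 18) * (T : ℝ) ^ 6) * Real.exp (2 * D * ‖lam₁‖ * (T : ℝ) ^ 6) :=
              mul_le_mul h1 (hexpG i (ρ := 2 * T * (D * (T : ℝ) ^ 3)) (by positivity)
                (le_of_eq (by ring))) (Real.exp_pos _).le (Real.exp_pos _).le
          _ = Real.exp ((2 * D + 18) * (T : ℝ) ^ 6 + 2 * D * ‖lam₁‖ * (T : ℝ) ^ 6) := by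
              rw [← Real.exp_add]
          _ ≤ _ := by
              refine Real.exp_le_exp.2 ?_
              have : 0 ≤ (3 * h) * (T : ℝ) ^ 6 := by positivity
              rw [hc]
              nlinarith)
      (fun i j => hasSum_monomialExpCoeff _ _ _ _)
    refine this.trans ?_
    rw [hcardι, Finset.prod_const, Finset.card_univ, hcardι, hMpow, ← div_eq_mul_one_div]
    gcongr
    have h2 : (2 : ℝ) ^ (T ^ 6) ≤ Real.exp ((T : ℝ) ^ 12) := by
      calc (2 : ℝ) ^ (T ^ 6) ≤ Real.exp 1 ^ (T ^ 6) := by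
            gcongr
            linarith [Real.add_one_le_exp (1 : ℝ)]
        _ = Real.exp ((T : ℝ) ^ 6) := by
            rw [← Real.exp_nat_mul]
            push_cast
            ring_nf
        _ ≤ _ := Real.exp_le_exp.2 (hTpow (by norm_num))
    calc _ ≤ Real.exp (6 * (T : ℝ) ^ 12) * Real.exp ((T : ℝ) ^ 12) * Real.exp (c * (T : ℝ) ^ 12) := by
          gcongr
      _ = _ := by
          rw [← Real.exp_add, ← Real.exp_add]
          ring_nf
  have hdiff : ∀ i j, ‖σ (B i j) - G i j‖ ≤ M * (2 * ‖Λ‖) := fun i j => by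
    have hsplit : σ (B i j) - G i j =
        G i j * (Complex.exp (((i.2 : ℕ) * ((f j).2 : ℕ)) * (Λ / b)) - 1) := by
      simp only [hB, A, G, Matrix.submatrix_apply, Matrix.of_apply, id]
      rw [map_mul, map_pow, map_intCast, hw, map_pow, map_mul, map_pow, map_pow, h₁, h₂,
        ← Complex.exp_nat_mul, ← Complex.exp_nat_mul, ← Complex.exp_add, ← Complex.exp_nat_mul]
      have key : ((i.2 : ℕ) : ℂ) * (((f j).1 : ℕ) * lam₁ + ((f j).2 : ℕ) * lam₂) =
          (i.2 : ℕ) * lam₁ * x j + ((i.2 : ℕ) * ((f j).2 : ℕ)) * (Λ / b) := by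
        simp only [hx, hΛdef]
        field_simp
        ring
      rw [key, Complex.exp_add]
      ring
    have hnorm : ‖((i.2 : ℕ) * ((f j).2 : ℕ) : ℂ) * (Λ / b)‖ ≤ ‖Λ‖ := by
      rw [norm_mul, norm_mul, norm_div, Complex.norm_natCast, Complex.norm_natCast,
        Complex.norm_intCast, ← mul_div_assoc, div_le_iff₀ hbpos, mul_comm ‖Λ‖]
      gcongr
      calc _ ≤ (T : ℝ) ^ 2 * (T : ℝ) ^ 3 := by
            gcongr
            · exact hl i
            · exact hs j
        _ = (T : ℝ) ^ 5 := by ring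
        _ ≤ _ := hb5
    rw [hsplit, norm_mul]
    gcongr
    · exact hGle i j
    · exact (Complex.norm_exp_sub_one_le (hnorm.trans hΛ)).trans (by gcongr)
  have hdetdiff : ‖σ B.det - G.det‖ ≤ Real.exp ((15 + 2 * c) * (T : ℝ) ^ 12) * ‖Λ‖ := by
    rw [σ.map_det]
    refine (Matrix.norm_det_sub_det_le hM1 (fun i j => hBle σ i j) hGle hdiff).trans ?_
    rw [hcardι, hMpow]
    have hN : ((T ^ 6 : ℕ) : ℝ) ≤ Real.exp ((T : ℝ) ^ 12) := by
      push_cast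
      have := Real.add_one_le_exp ((T : ℝ) ^ 12)
      linarith [hTpow (show 6 ≤ 12 by norm_num)]
    have h2 : (2 : ℝ) ≤ Real.exp ((T : ℝ) ^ 12) := by
      have := Real.add_one_le_exp ((T : ℝ) ^ 12)
      have := one_le_pow₀ hT1 (n := 12)
      linarith
    have hM' : M ≤ Real.exp (c * (T : ℝ) ^ 12) := by
      refine Real.exp_le_exp.2 ?_
      have := hTpow (show 6 ≤ 12 by norm_num)
      gcongr
    calc _ ≤ Real.exp (6 * (T : ℝ) ^ 12) * (Real.exp ((T : ℝ) ^ 12) * Real.exp (c * (T : ℝ) ^ 12) *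
          (Real.exp (c * (T : ℝ) ^ 12) * (Real.exp ((T : ℝ) ^ 12) * ‖Λ‖))) := by gcongr
      _ = Real.exp ((8 + 2 * c) * (T : ℝ) ^ 12) * ‖Λ‖ := by
          rw [show (8 + 2 * c) * (T : ℝ) ^ 12 = 6 * (T : ℝ) ^ 12 + ((T : ℝ) ^ 12 + c * (T : ℝ) ^ 12 +
            (c * (T : ℝ) ^ 12 + (T : ℝ) ^ 12)) by ring, Real.exp_add, Real.exp_add, Real.exp_add,
            Real.exp_add]
          ring
      _ ≤ _ := by
          gcongr
          norm_num
  have hσ : ‖σ B.det‖ ≤ Real.exp ((15 + 2 * c) * (T : ℝ) ^ 12) *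
      (1 / (T : ℝ) ^ (T ^ 6).choose 2 + ‖Λ‖) := by
    calc ‖σ B.det‖ = ‖G.det + (σ B.det - G.det)‖ := by rw [add_sub_cancel]
      _ ≤ ‖G.det‖ + ‖σ B.det - G.det‖ := norm_add_le _ _
      _ ≤ Real.exp ((15 + 2 * c) * (T : ℝ) ^ 12) * (1 / (T : ℝ) ^ (T ^ 6).choose 2) +
          Real.exp ((15 + 2 * c) * (T : ℝ) ^ 12) * ‖Λ‖ := by
          refine add_le_add (hGdet.trans ?_) hdetdiff
          gcongr
          · norm_num
          · linarith
      _ = _ := by ring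
  calc (1 : ℝ) ≤ ‖σ B.det‖ * Real.exp ((6 + c) * (T : ℝ) ^ 12) ^ d := hLiouville
    _ ≤ (Real.exp ((15 + 2 * c) * (T : ℝ) ^ 12) * (1 / (T : ℝ) ^ (T ^ 6).choose 2 + ‖Λ‖)) *
        Real.exp ((6 + c) * (T : ℝ) ^ 12) ^ d := by gcongr
    _ = _ := by
        rw [← Real.exp_nat_mul, mul_right_comm, ← Real.exp_add]
        congr 2
        ring

theorem Set.Finite.exists_pos_forall_le {ι : Type*} {s : Set ι} (hs : s.Finite) {f : ι → ℝ}
    (hf : ∀ i ∈ s, 0 < f i) : ∃ c : ℝ, 0 < c ∧ ∀ i ∈ s, c ≤ f i := by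
  rcases s.eq_empty_or_nonempty with rfl | hne
  · exact ⟨1, one_pos, by simp⟩
  · obtain ⟨i, hi, hmin⟩ := hs.exists_minimalFor f s hne
    refine ⟨f i, hf i hi, fun j hj => ?_⟩
    by_contra hlt
    exact hlt (hmin hj (not_le.1 hlt).le)

/-- The interpolation inequality fails for large `T` and exponentially small linear forms. -/
theorem exists_forall_exp_mul_lt_one {C : ℝ} (hC : 0 < C) {ε : ℝ} (hε : 0 < ε) :
    ∃ T₀ : ℕ, ∀ T : ℕ, T₀ ≤ T →
    Real.exp (C * (T : ℝ) ^ 12) *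
      (1 / (T : ℝ) ^ (T ^ 6).choose 2 + Real.exp (-ε * (T : ℝ) ^ 13)) < 1 := by
  obtain ⟨T₀, hT₀⟩ := exists_nat_ge (max 2 (max (Real.exp (4 * (C + 1))) ((C + 1) / ε)))
  refine ⟨T₀, fun T hT => ?_⟩
  have hT' : max 2 (max (Real.exp (4 * (C + 1))) ((C + 1) / ε)) ≤ (T : ℝ) :=
    hT₀.trans (by exact_mod_cast hT)
  simp only [max_le_iff] at hT'
  obtain ⟨h2, hexp, hεT⟩ := hT'
  rw [div_le_iff₀ hε] at hεT
  have hT0 : (0 : ℝ) < T := by linarith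
  have hlog : 4 * (C + 1) ≤ Real.log T := (Real.le_log_iff_exp_le hT0).2 hexp
  have hlog0 : 0 ≤ Real.log T := Real.log_nonneg (by linarith)
  have h12 : (1 : ℝ) ≤ (T : ℝ) ^ 12 := one_le_pow₀ (by linarith)
  have h6 : (2 : ℝ) ≤ (T : ℝ) ^ 6 := h2.trans (le_self_pow₀ (by linarith) (by norm_num))
  have hchoose : (T : ℝ) ^ 12 / 4 ≤ ((T ^ 6).choose 2 : ℕ) := by
    rw [Nat.cast_choose_two]
    push_cast
    nlinarith
  have hfirst : Real.exp (C * (T : ℝ) ^ 12) * (1 / (T : ℝ) ^ (T ^ 6).choose 2) ≤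
      Real.exp (-1) := by
    rw [← Real.exp_log (pow_pos hT0 ((T ^ 6).choose 2)), Real.log_pow, one_div, ← Real.exp_neg, ← Real.exp_add]
    refine Real.exp_le_exp.2 ?_
    have := mul_le_mul hchoose hlog (by positivity) (by positivity)
    nlinarith
  have hsecond : Real.exp (C * (T : ℝ) ^ 12) * Real.exp (-ε * (T : ℝ) ^ 13) ≤ Real.exp (-1) := by
    rw [← Real.exp_add]
    refine Real.exp_le_exp.2 ?_
    have : (T : ℝ) ^ 13 = T * (T : ℝ) ^ 12 := by ring
    nlinarith
  have hexp1 : Real.exp (-1) < 1 / 2 := by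
    rw [Real.exp_neg, one_div]
    exact inv_strictAnti₀ two_pos (by linarith [Real.exp_one_gt_d9])
  rw [mul_add]
  linarith

theorem exists_pow_le_lt_pow_succ (k : ℕ) {K n : ℕ} (hk : k ≠ 0) (hK : K ^ k ≤ n) :
    ∃ T : ℕ, K ≤ T ∧ T ^ k ≤ n ∧ n < (T + 1) ^ k := by
  have hex : ∃ T : ℕ, n < (T + 1) ^ k :=
    ⟨n, (Nat.lt_succ_self n).trans_le (Nat.le_self_pow hk _)⟩
  classical
  refine ⟨Nat.find hex, ?_, ?_, Nat.find_spec hex⟩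
  · by_contra! hlt
    exact absurd ((Nat.find_spec hex).trans_le (Nat.pow_le_pow_left hlt k)) (not_lt.2 hK)
  · rcases Nat.eq_zero_or_pos (Nat.find hex) with h | h
    · simp [h, hk]
    · have := Nat.find_min hex (Nat.sub_lt h one_pos)
      rwa [show Nat.find hex - 1 + 1 = Nat.find hex from Nat.sub_add_cancel h, not_lt] at this

/-- **Gelfond's theorem**: homogeneous linear forms in two logarithms of algebraic integers
are not exponentially small. -/
theorem exists_mul_exp_le_norm_linear_form {lam₁ lam₂ : ℂ} (h₁ : IsIntegral ℤ (Complex.exp lam₁))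
    (h₂ : IsIntegral ℤ (Complex.exp lam₂)) (hroot : ∀ n : ℕ, 0 < n → Complex.exp lam₁ ^ n ≠ 1)
    (hind : ∀ a b : ℤ, (a : ℂ) * lam₁ + b * lam₂ = 0 → a = 0 ∧ b = 0) {ε : ℝ} (hε : 0 < ε) :
    ∃ C : ℝ, 0 < C ∧ ∀ a b : ℤ, (a, b) ≠ 0 →
      C * Real.exp (-ε * (|(a : ℝ)| + |(b : ℝ)|)) ≤ ‖(a : ℂ) * lam₁ + b * lam₂‖ := by
  let F := IntermediateField.adjoin ℚ ({Complex.exp lam₁, Complex.exp lam₂} : Set ℂ)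
  have hfin : FiniteDimensional ℚ F := IntermediateField.finiteDimensional_adjoin (by
    rintro x (rfl | rfl)
    · exact h₁.tower_top
    · exact h₂.tower_top)
  have hNF : NumberField F := { to_charZero := inferInstance, to_finiteDimensional := hfin }
  let α : F := ⟨Complex.exp lam₁, IntermediateField.subset_adjoin _ _ (by simp)⟩
  let β : F := ⟨Complex.exp lam₂, IntermediateField.subset_adjoin _ _ (by simp)⟩
  have hinj : Function.Injective (algebraMap F ℂ) := (algebraMap F ℂ).injective
  have hα : IsIntegral ℤ α := (isIntegral_algebraMap_iff hinj).1 h₁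
  have hβ : IsIntegral ℤ β := (isIntegral_algebraMap_iff hinj).1 h₂
  have hlam0 : lam₁ ≠ 0 := by
    rintro rfl
    exact absurd (hind 1 0 (by simp)).1 one_ne_zero
  have hlam0' : 0 < ‖lam₁‖ := norm_pos_iff.2 hlam0
  obtain ⟨C, hC0, hC⟩ := one_le_exp_mul_of_interpolation (algebraMap F ℂ) hα hβ
    (fun n hn h => hroot n hn (by simpa [α] using congrArg (algebraMap F ℂ) h)) (lam₁ := lam₁)
    (lam₂ := lam₂) rfl rfl (C₁ := (1 + ‖lam₂‖) / ‖lam₁‖) (by positivity)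
  obtain ⟨T₀, hT₀⟩ := exists_forall_exp_mul_lt_one hC0 hε
  set K := max T₀ (2 ^ 13) with hK
  have hlarge : ∀ a b : ℤ, IsCoprime a b → K ^ 13 ≤ b.natAbs →
      Real.exp (-ε * |(b : ℝ)|) ≤ ‖(a : ℂ) * lam₁ + b * lam₂‖ := by
    intro a b hab hb
    by_contra! hlt
    obtain ⟨T, hKT, hTb, hbT⟩ := exists_pow_le_lt_pow_succ 13 (by norm_num) hb
    have h2T : 2 ^ 13 ≤ T := (le_max_right _ _).trans hKT
    have hbcast : ((b.natAbs : ℕ) : ℝ) = |(b : ℝ)| := by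
      rw [Nat.cast_natAbs, Int.cast_abs]
    have hTb' : (T : ℝ) ^ 13 ≤ |(b : ℝ)| := by
      rw [← hbcast]
      exact_mod_cast hTb
    have hT1 : (1 : ℝ) ≤ T := by exact_mod_cast (show 1 ≤ T by lia)
    have hb1 : 1 ≤ |(b : ℝ)| := (one_le_pow₀ hT1).trans hTb'
    have hle1 : ‖(a : ℂ) * lam₁ + b * lam₂‖ ≤ 1 :=
      hlt.le.trans (Real.exp_le_one_iff.2 (by nlinarith))
    have h14 : |(b : ℝ)| ≤ (T : ℝ) ^ 14 := by
      rw [← hbcast]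
      have : (T + 1) ^ 13 ≤ T ^ 14 := by
        calc (T + 1) ^ 13 ≤ (2 * T) ^ 13 := Nat.pow_le_pow_left (by lia) _
          _ = 2 ^ 13 * T ^ 13 := by rw [mul_pow]
          _ ≤ T * T ^ 13 := Nat.mul_le_mul_right _ h2T
          _ = T ^ 14 := by ring
      exact_mod_cast hbT.le.trans this
    have ha : |(a : ℝ)| ≤ (1 + ‖lam₂‖) / ‖lam₁‖ * |(b : ℝ)| := by
      rw [div_mul_eq_mul_div, le_div_iff₀ hlam0']
      have : ‖(a : ℂ) * lam₁‖ ≤ ‖(a : ℂ) * lam₁ + b * lam₂‖ + ‖(b : ℂ) * lam₂‖ := by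
        simpa using norm_sub_le ((a : ℂ) * lam₁ + b * lam₂) (b * lam₂)
      rw [norm_mul, norm_mul, Complex.norm_intCast, Complex.norm_intCast] at this
      nlinarith
    have hmain := hC T (by lia) a b hab ((pow_le_pow_right₀ hT1 (by norm_num)).trans hTb') ha h14
      hle1
    refine absurd (hT₀ T ((le_max_left _ _).trans hKT)) (not_lt.2 (hmain.trans ?_))
    gcongr
    refine hlt.le.trans (Real.exp_le_exp.2 ?_)
    nlinarith
  obtain ⟨N, hN⟩ := exists_nat_ge ((1 + (K : ℝ) ^ 13 * ‖lam₂‖) / ‖lam₁‖)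
  obtain ⟨c, hc0, hc⟩ := Set.Finite.exists_pos_forall_le
    (s := (Set.Icc (-(N : ℤ)) N ×ˢ Set.Icc (-(K ^ 13 : ℤ)) (K ^ 13)) \ {0})
    (((Set.finite_Icc _ _).prod (Set.finite_Icc _ _)).subset Set.sdiff_subset)
    (f := fun p : ℤ × ℤ => ‖(p.1 : ℂ) * lam₁ + p.2 * lam₂‖) (fun p hp => norm_pos_iff.2 fun h =>
      hp.2 (Prod.ext (hind _ _ h).1 (hind _ _ h).2))
  have hcop : ∀ a b : ℤ, IsCoprime a b →
      min 1 c * Real.exp (-ε * (|(a : ℝ)| + |(b : ℝ)|)) ≤ ‖(a : ℂ) * lam₁ + b * lam₂‖ := by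
    intro a b hab
    have hexp1 : Real.exp (-ε * (|(a : ℝ)| + |(b : ℝ)|)) ≤ 1 := by
      rw [Real.exp_le_one_iff, neg_mul, neg_nonpos]
      positivity
    rcases le_or_gt (K ^ 13) b.natAbs with hb | hb
    · refine le_trans ?_ (hlarge a b hab hb)
      refine (mul_le_of_le_one_left (Real.exp_pos _).le (min_le_left _ _)).trans ?_
      refine Real.exp_le_exp.2 ?_
      nlinarith [abs_nonneg (a : ℝ)]
    · refine (mul_le_of_le_one_right (by positivity) hexp1).trans ?_
      have hbK : |(b : ℝ)| ≤ (K : ℝ) ^ 13 := by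
        have : ((b.natAbs : ℕ) : ℝ) = |(b : ℝ)| := by rw [Nat.cast_natAbs, Int.cast_abs]
        rw [← this]
        exact_mod_cast hb.le
      rcases le_or_gt |(a : ℝ)| N with ha | ha
      · refine (min_le_right _ _).trans (hc (a, b) ⟨⟨?_, ?_⟩, ?_⟩)
        · exact abs_le.1 (by exact_mod_cast ha)
        · exact abs_le.1 (by exact_mod_cast hbK)
        · rintro h
          simp only [Set.mem_singleton_iff, Prod.mk_eq_zero] at h
          rw [h.1, h.2] at hab
          exact not_isCoprime_zero_zero hab
      · refine (min_le_left _ _).trans ?_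
        have hla : 1 + (K : ℝ) ^ 13 * ‖lam₂‖ ≤ |(a : ℝ)| * ‖lam₁‖ := by
          rw [← div_le_iff₀ hlam0']
          exact hN.trans ha.le
        have : ‖(a : ℂ) * lam₁‖ ≤ ‖(a : ℂ) * lam₁ + b * lam₂‖ + ‖(b : ℂ) * lam₂‖ := by
          simpa using norm_sub_le ((a : ℂ) * lam₁ + b * lam₂) (b * lam₂)
        rw [norm_mul, norm_mul, Complex.norm_intCast, Complex.norm_intCast] at this
        nlinarith [norm_nonneg lam₂]
  refine ⟨min 1 c, lt_min one_pos hc0, fun a b hab => ?_⟩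
  have hg : 0 < Int.gcd a b := by
    refine Int.gcd_pos_iff.2 ?_
    by_contra! h
    exact hab (Prod.ext h.1 h.2)
  obtain ⟨g, a', b', hg', hab', rfl, rfl⟩ : ∃ (g : ℕ) (a' b' : ℤ), 0 < g ∧ IsCoprime a' b' ∧
      a = a' * g ∧ b = b' * g := by
    obtain ⟨a', b', h, ha, hb⟩ := Int.exists_gcd_one hg
    exact ⟨Int.gcd a b, a', b', hg, Int.isCoprime_iff_gcd_eq_one.2 h, ha, hb⟩
  have hg1 : (1 : ℝ) ≤ g := by exact_mod_cast hg'
  have hnorm : ‖((a' * g : ℤ) : ℂ) * lam₁ + ((b' * g : ℤ) : ℂ) * lam₂‖ =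
      g * ‖(a' : ℂ) * lam₁ + b' * lam₂‖ := by
    rw [← Complex.norm_natCast g, ← norm_mul]
    push_cast
    ring_nf
  rw [hnorm]
  have hexp : Real.exp (-ε * (|((a' * g : ℤ) : ℝ)| + |((b' * g : ℤ) : ℝ)|)) ≤
      Real.exp (-ε * (|(a' : ℝ)| + |(b' : ℝ)|)) := by
    refine Real.exp_le_exp.2 ?_
    push_cast
    rw [abs_mul, abs_mul, Nat.abs_cast, ← add_mul, ← mul_assoc]
    have : 0 ≤ ε * (|(a' : ℝ)| + |(b' : ℝ)|) := by positivity
    nlinarith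
  calc _ ≤ min 1 c * Real.exp (-ε * (|(a' : ℝ)| + |(b' : ℝ)|)) := by gcongr
    _ ≤ ‖(a' : ℂ) * lam₁ + b' * lam₂‖ := hcop a' b' hab'
    _ ≤ _ := le_mul_of_one_le_left (norm_nonneg _) hg1

theorem Real.min_abs_one_half_le_abs_exp_sub_one (x : ℝ) :
    min |x| 1 / 2 ≤ |Real.exp x - 1| := by
  rcases le_or_gt 0 x with hx | hx
  · have h := Real.add_one_le_exp x
    rw [abs_of_nonneg hx, abs_of_nonneg (by linarith)]
    linarith [min_le_left x 1]
  · have h := Real.add_one_le_exp (-x)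
    have h1 : Real.exp x < 1 := by rw [← Real.exp_zero]; exact Real.exp_lt_exp.2 hx
    rw [abs_of_neg hx, abs_of_neg (by linarith)]
    have h2 : Real.exp x * Real.exp (-x) = 1 := by rw [← Real.exp_add]; simp
    have h3 : Real.exp x * (-x + 1) ≤ 1 :=
      (mul_le_mul_of_nonneg_left h (Real.exp_pos x).le).trans h2.le
    rcases le_total (-x) 1 with h4 | h4
    · rw [min_eq_left h4]
      nlinarith
    · rw [min_eq_right h4]
      nlinarith [Real.exp_pos x]

theorem isIntegral_zpow {K : Type*} [Field K] {a : K} (ha : IsIntegral ℤ a)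
    (ha' : IsIntegral ℤ a⁻¹) (n : ℤ) : IsIntegral ℤ (a ^ n) := by
  cases n with
  | ofNat n => simpa using ha.pow n
  | negSucc n => simpa using ha'.pow (n + 1)

/-- Integral powers of an algebraic integer that is not a root of unity are not exponentially
close to `1`. -/
theorem exists_mul_exp_le_norm_zpow_sub_one {γ : ℂ} (hγ0 : γ ≠ 0) (hγ : IsIntegral ℤ γ)
    (hroot : ∀ n : ℤ, γ ^ n = 1 → n = 0) {ε : ℝ} (hε : 0 < ε) :
    ∃ C : ℝ, 0 < C ∧ ∀ t : ℤ, t ≠ 0 → C * Real.exp (-ε * |(t : ℝ)|) ≤ ‖γ ^ t - 1‖ := by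
  have hexp : Complex.exp (Complex.log γ) = γ := Complex.exp_log hγ0
  have hexp' : ∀ t : ℤ, Complex.exp (t * Complex.log γ) = γ ^ t := fun t => by
    rw [Complex.exp_int_mul, hexp]
  set c := ‖Complex.log γ‖ with hc
  have hc0 : 0 ≤ c := norm_nonneg _
  obtain ⟨C, hC0, hC⟩ := exists_mul_exp_le_norm_linear_form (lam₁ := Complex.log γ)
    (lam₂ := 2 * Real.pi * Complex.I) (ε := ε / (1 + c)) (by rwa [hexp])
    (by rw [Complex.exp_two_pi_mul_I]; exact isIntegral_one)
    (fun n hn h => by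
      rw [hexp] at h
      have := hroot n (by exact_mod_cast h)
      lia)
    (fun a b hab => by
      have ha : a = 0 := by
        refine hroot a ?_
        rw [← hexp', eq_neg_of_add_eq_zero_left hab, ← neg_mul,
          show (-(b : ℂ)) = ((-b : ℤ) : ℂ) by push_cast; rfl, Complex.exp_int_mul,
          Complex.exp_two_pi_mul_I, _root_.one_zpow]
      subst ha
      simpa [Complex.two_pi_I_ne_zero, Real.pi_ne_zero] using hab)
    (by positivity)
  refine ⟨min (1 / 2) (C / 2 * Real.exp (-ε)), by positivity, fun t ht => ?_⟩
  have hexp1 : Real.exp (-ε * |(t : ℝ)|) ≤ 1 := by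
    rw [Real.exp_le_one_iff, neg_mul, neg_nonpos]
    positivity
  rcases le_or_gt ‖γ ^ t - 1‖ (1 / 2) with hle | hgt
  · have hlog := Complex.norm_log_one_add_half_le_self hle
    rw [add_sub_cancel] at hlog
    obtain ⟨n, hn⟩ := Complex.exp_eq_exp_iff_exists_int.1
      ((Complex.exp_log (zpow_ne_zero t hγ0)).trans (hexp' t).symm)
    have hnle : |(n : ℝ)| ≤ |(t : ℝ)| * c + 1 := by
      have h1 : ‖(n : ℂ) * (2 * Real.pi * Complex.I)‖ ≤
          ‖Complex.log (γ ^ t)‖ + ‖(t : ℂ) * Complex.log γ‖ := by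
        rw [← sub_eq_iff_eq_add'.2 hn]
        exact norm_sub_le _ _
      rw [norm_mul (n : ℂ), norm_mul (t : ℂ), Complex.norm_intCast, Complex.norm_intCast] at h1
      have h2 : ‖(2 * Real.pi * Complex.I : ℂ)‖ = 2 * Real.pi := by
        simp [abs_of_pos Real.pi_pos]
      rw [h2] at h1
      nlinarith [Real.pi_gt_three, abs_nonneg (n : ℝ)]
    have hmain := hC t n (by simp [ht])
    rw [← hn] at hmain
    have hexple : Real.exp (-ε) * Real.exp (-ε * |(t : ℝ)|) ≤
        Real.exp (-(ε / (1 + c)) * (|(t : ℝ)| + |(n : ℝ)|)) := by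
      rw [← Real.exp_add]
      refine Real.exp_le_exp.2 ?_
      have h3 : ε / (1 + c) * (|(t : ℝ)| + |(n : ℝ)|) ≤
          ε / (1 + c) * ((1 + c) * (|(t : ℝ)| + 1)) := by
        gcongr
        nlinarith
      have h4 : ε / (1 + c) * ((1 + c) * (|(t : ℝ)| + 1)) = ε * (|(t : ℝ)| + 1) := by
        field_simp
      linarith
    calc _ ≤ C / 2 * Real.exp (-ε) * Real.exp (-ε * |(t : ℝ)|) := by
          gcongr
          exact min_le_right _ _
      _ = 1 / 2 * (C * (Real.exp (-ε) * Real.exp (-ε * |(t : ℝ)|))) := by ring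
      _ ≤ 1 / 2 * ‖Complex.log (γ ^ t)‖ := by
          gcongr
          exact le_trans (by gcongr) hmain
      _ ≤ _ := by linarith [norm_nonneg (γ ^ t - 1)]
  · exact ((mul_le_of_le_one_right (by positivity) hexp1).trans (min_le_left _ _)).trans hgt.le

/-- Monomials in two multiplicatively independent units, not both of absolute value `1`,
are not exponentially close to `1`. -/
theorem exists_mul_exp_le_norm_monomial_sub_one {a₁ a₂ : ℂ} (h₁ : IsIntegral ℤ a₁)
    (h₁' : IsIntegral ℤ a₁⁻¹) (h₂ : IsIntegral ℤ a₂) (h₂' : IsIntegral ℤ a₂⁻¹) (h₁0 : a₁ ≠ 0)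
    (h₂0 : a₂ ≠ 0) (hind : ∀ m n : ℤ, a₁ ^ m * a₂ ^ n = 1 → m = 0 ∧ n = 0)
    (hL : Real.log ‖a₁‖ ≠ 0 ∨ Real.log ‖a₂‖ ≠ 0) {ε : ℝ} (hε : 0 < ε) :
    ∃ C : ℝ, 0 < C ∧ ∀ m n : ℤ, (m, n) ≠ 0 →
      C * Real.exp (-ε * (|(m : ℝ)| + |(n : ℝ)|)) ≤ ‖a₁ ^ m * a₂ ^ n - 1‖ := by
  set x := Real.log ‖a₁‖ with hx
  set y := Real.log ‖a₂‖ with hy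
  have hxe : Real.exp x = ‖a₁‖ := Real.exp_log (norm_pos_iff.2 h₁0)
  have hye : Real.exp y = ‖a₂‖ := Real.exp_log (norm_pos_iff.2 h₂0)
  have hnorm : ∀ m n : ℤ, ‖a₁ ^ m * a₂ ^ n‖ = Real.exp (m * x + n * y) := fun m n => by
    rw [norm_mul, norm_zpow, norm_zpow, ← hxe, ← hye, Real.exp_add, mul_comm (m : ℝ),
      mul_comm (n : ℝ), Real.exp_mul, Real.exp_mul, Real.rpow_intCast, Real.rpow_intCast]
  have hlow : ∀ m n : ℤ, min |m * x + n * y| 1 / 2 ≤ ‖a₁ ^ m * a₂ ^ n - 1‖ := fun m n => by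
    refine (Real.min_abs_one_half_le_abs_exp_sub_one _).trans ?_
    rw [← hnorm]
    simpa using abs_norm_sub_norm_le (a₁ ^ m * a₂ ^ n) 1
  have hexp1 : ∀ m n : ℤ, Real.exp (-ε * (|(m : ℝ)| + |(n : ℝ)|)) ≤ 1 := fun m n => by
    rw [Real.exp_le_one_iff, neg_mul, neg_nonpos]
    positivity
  have hsq : ∀ {a : ℂ} {z : ℝ}, IsIntegral ℤ a → Real.exp z = ‖a‖ →
      IsIntegral ℤ (Complex.exp ((2 * z : ℝ) : ℂ)) := fun {a z} ha hz => by
    have : Complex.exp ((2 * z : ℝ) : ℂ) = a * starRingEnd ℂ a := by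
      rw [Complex.mul_conj', ← Complex.ofReal_exp, ← hz, two_mul, Real.exp_add, ← pow_two]
      push_cast
      rfl
    rw [this]
    exact ha.mul (ha.map (starRingEnd ℂ).toIntAlgHom)
  by_cases hdep : ∀ p q : ℤ, p * x + q * y = 0 → p = 0 ∧ q = 0
  · have hx0 : x ≠ 0 := fun h => absurd (hdep 1 0 (by simp [h])).1 one_ne_zero
    obtain ⟨C, hC0, hC⟩ := exists_mul_exp_le_norm_linear_form (hsq h₁ hxe) (hsq h₂ hye)
      (fun n hn h => by
        rw [← Complex.exp_nat_mul, ← Complex.ofReal_natCast, ← Complex.ofReal_mul,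
          ← Complex.ofReal_exp, Complex.ofReal_eq_one, Real.exp_eq_one_iff] at h
        simp [hx0, hn.ne'] at h)
      (fun a b hab => hdep a b (by
        have : (a : ℝ) * (2 * x) + b * (2 * y) = 0 := by exact_mod_cast hab
        linarith)) hε
    refine ⟨min (C / 2) 1 / 2, by positivity, fun m n hmn => ?_⟩
    refine le_trans ?_ (hlow m n)
    have hmain := hC m n hmn
    have : ‖(m : ℂ) * ((2 * x : ℝ) : ℂ) + n * ((2 * y : ℝ) : ℂ)‖ = 2 * |m * x + n * y| := by
      rw [show (m : ℂ) * ((2 * x : ℝ) : ℂ) + n * ((2 * y : ℝ) : ℂ) =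
        ((2 * (m * x + n * y) : ℝ) : ℂ) by push_cast; ring, Complex.norm_real, Real.norm_eq_abs,
        abs_mul, abs_two]
    rw [this] at hmain
    have hE := hexp1 m n
    rw [div_mul_eq_mul_div]
    gcongr
    refine le_min ?_ ?_
    · calc _ ≤ C / 2 * Real.exp (-ε * (|(m : ℝ)| + |(n : ℝ)|)) := by
            gcongr
            exact min_le_left _ _
        _ ≤ _ := by linarith
    · exact mul_le_one₀ (min_le_right _ _) (Real.exp_pos _).le hE
  · obtain ⟨p, q, r, s, hrs, hpq⟩ : ∃ p q r s : ℤ, r * p + s * q = 1 ∧ p * x + q * y = 0 := by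
      push Not at hdep
      obtain ⟨p, q, hpq, hne⟩ := hdep
      have hg : 0 < Int.gcd p q := by
        refine Int.gcd_pos_iff.2 ?_
        by_contra! h
        exact hne h.1 h.2
      obtain ⟨p', q', h, hp, hq⟩ := Int.exists_gcd_one hg
      obtain ⟨r, s, hrs⟩ := Int.isCoprime_iff_gcd_eq_one.2 h
      refine ⟨p', q', r, s, hrs, ?_⟩
      have hg' : (Int.gcd p q : ℝ) ≠ 0 := by exact_mod_cast hg.ne'
      refine mul_left_cancel₀ hg' ?_
      have hp' : (p : ℝ) = p' * Int.gcd p q := by exact_mod_cast hp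
      have hq' : (q : ℝ) = q' * Int.gcd p q := by exact_mod_cast hq
      linear_combination hpq - x * hp' - y * hq'
    set c := s * x - r * y with hc
    have hrs' : (r : ℝ) * p + s * q = 1 := by exact_mod_cast hrs
    have hxc : x = c * q := by linear_combination (-x) * hrs' + (r : ℝ) * hpq
    have hyc : y = -c * p := by linear_combination (-y) * hrs' + (s : ℝ) * hpq
    have hc0 : c ≠ 0 := by
      rintro h
      rw [h] at hxc hyc
      simp [hxc, hyc] at hL
    set γ := a₁ ^ p * a₂ ^ q with hγ
    have hγpow : ∀ t : ℤ, γ ^ t = a₁ ^ (p * t) * a₂ ^ (q * t) := fun t => by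
      rw [hγ, mul_zpow, _root_.zpow_mul, _root_.zpow_mul]
    obtain ⟨C, hC0, hC⟩ := exists_mul_exp_le_norm_zpow_sub_one (γ := γ)
      (mul_ne_zero (zpow_ne_zero _ h₁0) (zpow_ne_zero _ h₂0))
      ((isIntegral_zpow h₁ h₁' p).mul (isIntegral_zpow h₂ h₂' q))
      (fun n hn => by
        rw [hγpow] at hn
        obtain ⟨h1, h2⟩ := hind _ _ hn
        linear_combination (-n) * hrs + r * h1 + s * h2) hε
    refine ⟨min C (min |c| 1 / 2), by positivity, fun m n hmn => ?_⟩
    by_cases hk : m * q - n * p = 0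
    · set t := r * m + s * n with ht
      have hm : m = p * t := by linear_combination (-m) * hrs + s * hk
      have hn : n = q * t := by linear_combination (-n) * hrs - r * hk
      have ht0 : t ≠ 0 := by
        intro h
        rw [h] at hm hn
        exact hmn (by simp [hm, hn])
      have hmain := hC t ht0
      rw [hγpow, ← hm, ← hn] at hmain
      refine le_trans ?_ hmain
      have htle : |(t : ℝ)| ≤ |(m : ℝ)| + |(n : ℝ)| := by
        have : |t| ≤ |m| + |n| := by
          rcases eq_or_ne p 0 with hp | hp
          · have hq : q ≠ 0 := by
              rintro rfl
              simp [hp] at hrs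
            have := Int.one_le_abs hq
            rw [hn, abs_mul]
            nlinarith [abs_nonneg m, abs_nonneg t]
          · have := Int.one_le_abs hp
            rw [hm, abs_mul]
            nlinarith [abs_nonneg n, abs_nonneg t]
        exact_mod_cast this
      refine mul_le_mul (min_le_left _ _) (Real.exp_le_exp.2 ?_) (Real.exp_pos _).le hC0.le
      nlinarith
    · refine (mul_le_of_le_one_right (by positivity) (hexp1 m n)).trans ((min_le_right _ _).trans
        (le_trans ?_ (hlow m n)))
      have hk1 : (1 : ℝ) ≤ |(m : ℝ) * q - n * p| := by exact_mod_cast Int.one_le_abs hk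
      have : |c| ≤ |m * x + n * y| := by
        rw [show m * x + n * y = c * (m * q - n * p) by
          linear_combination (m : ℝ) * hxc + (n : ℝ) * hyc, abs_mul]
        exact le_mul_of_one_le_right (abs_nonneg _) hk1
      gcongr

/-- Four points of the plane coincide if a separating family of linear forms with zero sum
satisfies the following: no form takes a larger value at one point than at two of the others. -/
theorem eq_of_forall_linear_form_le_max {ι : Type*} [Fintype ι] {x y : ι → ℝ}
    (hx : ∑ σ, x σ = 0) (hy : ∑ σ, y σ = 0)
    (hker : ∀ w : ℝ × ℝ, (∀ σ, w.1 * x σ + w.2 * y σ = 0) → w = 0) {q : Fin 4 → ℝ × ℝ}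
    (hq : ∀ σ i j k, i ≠ k → (q j).1 * x σ + (q j).2 * y σ ≤
      max ((q i).1 * x σ + (q i).2 * y σ) ((q k).1 * x σ + (q k).2 * y σ)) (j k : Fin 4) :
    q j = q k := by
  by_cases hmax : ∃ i, ∀ σ j, (q j).1 * x σ + (q j).2 * y σ ≤ (q i).1 * x σ + (q i).2 * y σ
  · obtain ⟨i, hi⟩ := hmax
    suffices h : ∀ j, q i = q j from (h j).symm.trans (h k)
    intro j
    have hsum : ∑ σ, (((q i).1 * x σ + (q i).2 * y σ) - ((q j).1 * x σ + (q j).2 * y σ)) = 0 := by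
      simp only [Finset.sum_sub_distrib, Finset.sum_add_distrib, ← Finset.mul_sum, hx, hy]
      simp
    have hzero := (Finset.sum_eq_zero_iff_of_nonneg fun σ _ => sub_nonneg.2 (hi σ j)).1 hsum
    refine sub_eq_zero.1 (hker _ fun σ => ?_)
    have := hzero σ (Finset.mem_univ σ)
    simp only [Prod.fst_sub, Prod.snd_sub]
    linarith
  · push Not at hmax
    have hsep : ∀ i, ∃ σ, (∀ k, k ≠ i →
        (q i).1 * x σ + (q i).2 * y σ < (q k).1 * x σ + (q k).2 * y σ) ∧
        ∀ k l, k ≠ i → l ≠ i →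
          (q k).1 * x σ + (q k).2 * y σ = (q l).1 * x σ + (q l).2 * y σ := by
      intro i
      obtain ⟨σ, j, hj⟩ := hmax i
      have hlt : ∀ k, k ≠ i →
          (q i).1 * x σ + (q i).2 * y σ < (q k).1 * x σ + (q k).2 * y σ := by
        intro k hk
        rcases le_max_iff.1 (hq σ i j k hk.symm) with h | h
        · exact absurd h (not_le.2 hj)
        · exact hj.trans_le h
      have hle : ∀ k l, k ≠ i → l ≠ i →
          (q k).1 * x σ + (q k).2 * y σ ≤ (q l).1 * x σ + (q l).2 * y σ := by
        intro k l hk hl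
        rcases le_max_iff.1 (hq σ i k l hl.symm) with h | h
        · exact absurd h (not_le.2 (hlt k hk))
        · exact h
      exact ⟨σ, hlt, fun k l hk hl => le_antisymm (hle k l hk hl) (hle l k hl hk)⟩
    rcases eq_or_ne j k with rfl | hjk
    · rfl
    obtain ⟨i, i', hii, hij, hik, hij', hik'⟩ : ∃ i i' : Fin 4, i ≠ i' ∧ j ≠ i ∧ k ≠ i ∧
        j ≠ i' ∧ k ≠ i' := by
      revert j k
      decide
    obtain ⟨σ, hσ, hσ'⟩ := hsep i
    obtain ⟨τ, hτ, hτ'⟩ := hsep i'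
    have e₁ := hσ' j k hij hik
    have e₂ := hτ' j k hij' hik'
    have f₁ := hσ j hij
    have f₂ := hτ' i j hii hij'
    have g := hτ j hij'
    by_contra hne
    have hdet : x σ * y τ - x τ * y σ = 0 := by
      by_contra hdet
      refine hne (Prod.ext (sub_eq_zero.1 ?_) (sub_eq_zero.1 ?_)) <;>
        refine (mul_eq_zero.1 (?_ : (x σ * y τ - x τ * y σ) * _ = 0)).resolve_left hdet
      · linear_combination y τ * e₁ - y σ * e₂
      · linear_combination x σ * e₂ - x τ * e₁
    have hF : ((q i).1 * x σ + (q i).2 * y σ) - ((q j).1 * x σ + (q j).2 * y σ) ≠ 0 := by linarith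
    have hxτ : x τ = 0 := by
      refine (mul_eq_zero.1 (?_ : x τ * _ = 0)).resolve_right hF
      linear_combination x σ * f₂ - ((q i).2 - (q j).2) * hdet
    have hyτ : y τ = 0 := by
      refine (mul_eq_zero.1 (?_ : y τ * _ = 0)).resolve_right hF
      linear_combination y σ * f₂ + ((q i).1 - (q j).1) * hdet
    simp [hxτ, hyτ] at g

theorem sum_log_norm_embedding_eq_zero {F : Type*} [Field F] [NumberField F] {a : F} (ha0 : a ≠ 0)
    (ha : IsIntegral ℤ a) (ha' : IsIntegral ℤ a⁻¹) :
    ∑ τ : F →ₐ[ℚ] ℂ, Real.log ‖τ a‖ = 0 := by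
  have h1 := NumberField.one_le_prod_norm_embedding ha ha0
  have h2 := NumberField.one_le_prod_norm_embedding ha' (inv_ne_zero ha0)
  simp only [map_inv₀, norm_inv, Finset.prod_inv_distrib] at h2
  have h3 := (one_le_inv₀ (by positivity)).1 h2
  rw [← Real.log_prod fun τ _ => by simpa using ha0, le_antisymm h3 h1, Real.log_one]

/-- The logarithmic embedding is injective on the real span of two multiplicatively
independent units. -/
theorem eq_zero_of_forall_mul_log_norm_embedding_eq_zero {F : Type*} [Field F] [NumberField F]
    {a₁ a₂ : F} (h₁0 : a₁ ≠ 0) (h₂0 : a₂ ≠ 0) (h₁ : IsIntegral ℤ a₁) (h₁' : IsIntegral ℤ a₁⁻¹)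
    (h₂ : IsIntegral ℤ a₂) (h₂' : IsIntegral ℤ a₂⁻¹)
    (hind : ∀ m n : ℤ, a₁ ^ m * a₂ ^ n = 1 → m = 0 ∧ n = 0) {w : ℝ × ℝ}
    (hw : ∀ τ : F →ₐ[ℚ] ℂ, w.1 * Real.log ‖τ a₁‖ + w.2 * Real.log ‖τ a₂‖ = 0) : w = 0 := by
  have hinj : Function.Injective fun p : ℤ × ℤ => a₁ ^ p.1 * a₂ ^ p.2 := by
    rintro ⟨m, n⟩ ⟨m', n'⟩ h
    simp only at h
    obtain ⟨h3, h4⟩ := hind (m - m') (n - n') (by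
      have := zpow_ne_zero m' h₁0
      have := zpow_ne_zero n' h₂0
      rw [zpow_sub₀ h₁0, zpow_sub₀ h₂0]
      field_simp
      exact h)
    ext <;> lia
  set B : ℝ := ∑ τ : F →ₐ[ℚ] ℂ, (|Real.log ‖τ a₁‖| + |Real.log ‖τ a₂‖|) with hB
  let p : ℕ → ℤ × ℤ := fun n => (⌊n * w.1⌋, ⌊n * w.2⌋)
  have hfin : (Set.range p).Finite := by
    refine ((NumberField.Embeddings.finite_of_norm_le F ℂ (Real.exp B)).preimage
      hinj.injOn).subset ?_
    rintro _ ⟨n, rfl⟩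
    refine ⟨(isIntegral_zpow h₁ h₁' _).mul (isIntegral_zpow h₂ h₂' _), fun φ => ?_⟩
    let τ : F →ₐ[ℚ] ℂ := φ.toRatAlgHom
    have hτ : ∀ z, φ z = τ z := fun _ => rfl
    have hx0 : ‖τ a₁‖ ≠ 0 := by simpa using h₁0
    have hy0 : ‖τ a₂‖ ≠ 0 := by simpa using h₂0
    rw [hτ, map_mul, map_zpow₀, map_zpow₀, norm_mul, norm_zpow, norm_zpow, ← Real.log_le_iff_le_exp
      (by positivity), Real.log_mul (zpow_ne_zero _ hx0) (zpow_ne_zero _ hy0), Real.log_zpow,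
      Real.log_zpow]
    have hle : |Real.log ‖τ a₁‖| + |Real.log ‖τ a₂‖| ≤ B :=
      Finset.single_le_sum (f := fun τ : F →ₐ[ℚ] ℂ => |Real.log ‖τ a₁‖| + |Real.log ‖τ a₂‖|)
        (fun _ _ => by positivity) (Finset.mem_univ τ)
    have hfl : ∀ u v : ℝ, (⌊u⌋ - u) * v ≤ |v| := fun u v => by
      refine (le_abs_self _).trans ?_
      rw [abs_mul]
      refine mul_le_of_le_one_left (abs_nonneg _) (abs_le.2 ⟨?_, ?_⟩) <;>
        linarith [Int.floor_le u, Int.lt_floor_add_one u]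
    have h3 := hfl (n * w.1) (Real.log ‖τ a₁‖)
    have h4 := hfl (n * w.2) (Real.log ‖τ a₂‖)
    have h5 := congrArg (fun z => (n : ℝ) * z) (hw τ)
    nlinarith
  obtain ⟨M, hM⟩ := (hfin.image fun p : ℤ × ℤ => max |(p.1 : ℝ)| |(p.2 : ℝ)|).bddAbove
  have hbound : ∀ n : ℕ, |(⌊n * w.1⌋ : ℝ)| ≤ M ∧ |(⌊n * w.2⌋ : ℝ)| ≤ M := fun n =>
    max_le_iff.1 (hM ⟨p n, ⟨n, rfl⟩, rfl⟩)
  have hzero : ∀ v : ℝ, (∀ n : ℕ, |(⌊n * v⌋ : ℝ)| ≤ M) → v = 0 := by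
    intro v hv
    by_contra hv0
    obtain ⟨n, hn⟩ := exists_nat_gt ((M + 1) / |v|)
    rw [div_lt_iff₀ (abs_pos.2 hv0)] at hn
    have h3 : (n : ℝ) * |v| = |n * v| := by rw [abs_mul, Nat.abs_cast]
    have h4 := abs_le.1 (hv n)
    rw [h3] at hn
    refine absurd hn (not_lt.2 (abs_le.2 ⟨?_, ?_⟩)) <;>
      linarith [Int.floor_le (n * v), Int.lt_floor_add_one (n * v)]
  exact Prod.ext (hzero _ fun n => (hbound n).1) (hzero _ fun n => (hbound n).2)

/-- Sums and differences of two distinct monomials are, up to a subexponential factor, as large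
as their terms. -/
theorem exists_mul_exp_le_norm_intCast_add_monomial {a₁ a₂ : ℂ} (h₁ : IsIntegral ℤ a₁)
    (h₁' : IsIntegral ℤ a₁⁻¹) (h₂ : IsIntegral ℤ a₂) (h₂' : IsIntegral ℤ a₂⁻¹) (h₁0 : a₁ ≠ 0)
    (h₂0 : a₂ ≠ 0) (hind : ∀ m n : ℤ, a₁ ^ m * a₂ ^ n = 1 → m = 0 ∧ n = 0)
    (hL : Real.log ‖a₁‖ ≠ 0 ∨ Real.log ‖a₂‖ ≠ 0) {ε : ℝ} (hε : 0 < ε) :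
    ∃ C : ℝ, 0 < C ∧ ∀ (s t : ℤ) (m n : ℤ), (s = 1 ∨ s = -1) → (t = 1 ∨ t = -1) →
      (s + t = 0 → (m, n) ≠ 0) →
      C * Real.exp (-ε * (|(m : ℝ)| + |(n : ℝ)|)) ≤ ‖s + t * (a₁ ^ m * a₂ ^ n)‖ := by
  obtain ⟨C, hC0, hC⟩ := exists_mul_exp_le_norm_monomial_sub_one h₁ h₁' h₂ h₂' h₁0 h₂0 hind hL
    (half_pos hε)
  have hminus : ∀ m n : ℤ, (m, n) ≠ 0 →
      C * Real.exp (-ε * (|(m : ℝ)| + |(n : ℝ)|)) ≤ ‖a₁ ^ m * a₂ ^ n - 1‖ := fun m n hmn => by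
    refine le_trans ?_ (hC m n hmn)
    refine mul_le_mul_of_nonneg_left (Real.exp_le_exp.2 ?_) hC0.le
    have : 0 ≤ ε * (|(m : ℝ)| + |(n : ℝ)|) := by positivity
    linarith
  have hplus : ∀ m n : ℤ, min (C / 3) 1 * Real.exp (-ε * (|(m : ℝ)| + |(n : ℝ)|)) ≤
      ‖a₁ ^ m * a₂ ^ n + 1‖ := fun m n => by
    have hexp1 : Real.exp (-ε * (|(m : ℝ)| + |(n : ℝ)|)) ≤ 1 := by
      rw [Real.exp_le_one_iff, neg_mul, neg_nonpos]
      positivity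
    by_cases hmn : (m, n) = 0
    · obtain ⟨rfl, rfl⟩ := Prod.mk_eq_zero.1 hmn
      refine (mul_le_one₀ (min_le_right _ _) (Real.exp_pos _).le hexp1).trans ?_
      norm_num
    rcases le_or_gt ‖a₁ ^ m * a₂ ^ n + 1‖ 1 with hle | hgt
    · have hmain := hC (2 * m) (2 * n) (fun h => hmn (by
        obtain ⟨h3, h4⟩ := Prod.mk_eq_zero.1 h
        ext <;> simp <;> lia))
      have hfac : a₁ ^ (2 * m) * a₂ ^ (2 * n) - 1 =
          (a₁ ^ m * a₂ ^ n - 1) * (a₁ ^ m * a₂ ^ n + 1) := by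
        rw [two_mul, two_mul, zpow_add₀ h₁0, zpow_add₀ h₂0]
        ring
      have h3 : ‖a₁ ^ m * a₂ ^ n - 1‖ ≤ 3 := by
        have := norm_sub_le (a₁ ^ m * a₂ ^ n + 1) 2
        rw [show a₁ ^ m * a₂ ^ n + 1 - 2 = a₁ ^ m * a₂ ^ n - 1 by ring] at this
        norm_num at this
        linarith
      rw [hfac, norm_mul] at hmain
      have hexp : -(ε / 2) * (|((2 * m : ℤ) : ℝ)| + |((2 * n : ℤ) : ℝ)|) =
          -ε * (|(m : ℝ)| + |(n : ℝ)|) := by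
        push_cast
        rw [abs_mul, abs_mul, abs_two]
        ring
      rw [hexp] at hmain
      calc _ ≤ C / 3 * Real.exp (-ε * (|(m : ℝ)| + |(n : ℝ)|)) :=
            mul_le_mul_of_nonneg_right (min_le_left _ _) (Real.exp_pos _).le
        _ ≤ _ := by nlinarith [norm_nonneg (a₁ ^ m * a₂ ^ n + 1)]
    · exact (mul_le_one₀ (min_le_right _ _) (Real.exp_pos _).le hexp1).trans hgt.le
  refine ⟨min (C / 3) 1, by positivity, fun s t m n hs ht hst => ?_⟩
  have hminus' : (m, n) ≠ 0 → min (C / 3) 1 * Real.exp (-ε * (|(m : ℝ)| + |(n : ℝ)|)) ≤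
      ‖a₁ ^ m * a₂ ^ n - 1‖ := fun h => by
    refine le_trans (mul_le_mul_of_nonneg_right ((min_le_left _ _).trans ?_)
      (Real.exp_pos _).le) (hminus m n h)
    linarith
  rcases hs with rfl | rfl <;> rcases ht with rfl | rfl
  · simpa [add_comm] using hplus m n
  · refine (hminus' (hst (by norm_num))).trans (le_of_eq ?_)
    rw [← norm_neg]
    congr 1
    push_cast
    ring
  · refine (hminus' (hst (by norm_num))).trans (le_of_eq ?_)
    congr 1
    push_cast
    ring
  · refine (hplus m n).trans (le_of_eq ?_)
    rw [← norm_neg]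
    congr 1
    push_cast
    ring

theorem Fin.exists_univ_eq_of_four {i j k : Fin 4} (hij : i ≠ j) (hjk : j ≠ k) (hik : i ≠ k) :
    ∃ l, l ≠ i ∧ l ≠ j ∧ l ≠ k ∧ (Finset.univ : Finset (Fin 4)) = {j, l, i, k} := by
  revert i j k
  decide

/-- Among the terms of a vanishing four-term sum, each is at most comparable to the larger of
any two others. -/
theorem exists_linear_form_le_max_add {a₁ a₂ : ℂ} (h₁ : IsIntegral ℤ a₁)
    (h₁' : IsIntegral ℤ a₁⁻¹) (h₂ : IsIntegral ℤ a₂) (h₂' : IsIntegral ℤ a₂⁻¹) (h₁0 : a₁ ≠ 0)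
    (h₂0 : a₂ ≠ 0) (hind : ∀ m n : ℤ, a₁ ^ m * a₂ ^ n = 1 → m = 0 ∧ n = 0) {s : Fin 4 → ℤ}
    (hs : ∀ i, s i = 1 ∨ s i = -1) {ε : ℝ} (hε : 0 < ε) :
    ∃ K : ℝ, 0 ≤ K ∧ ∀ (p : Fin 4 → ℤ × ℤ) (N : ℝ), (∀ i, |((p i).1 : ℝ)| ≤ N) →
      (∀ i, |((p i).2 : ℝ)| ≤ N) → ∑ i, (s i : ℂ) * (a₁ ^ (p i).1 * a₂ ^ (p i).2) = 0 →
      (∀ i k, s i + s k = 0 → p i ≠ p k) → ∀ i j k, i ≠ k →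
      (p j).1 * Real.log ‖a₁‖ + (p j).2 * Real.log ‖a₂‖ ≤
        max ((p i).1 * Real.log ‖a₁‖ + (p i).2 * Real.log ‖a₂‖)
          ((p k).1 * Real.log ‖a₁‖ + (p k).2 * Real.log ‖a₂‖) + ε * N + K := by
  set x := Real.log ‖a₁‖ with hx
  set y := Real.log ‖a₂‖ with hy
  have hxe : Real.exp x = ‖a₁‖ := Real.exp_log (norm_pos_iff.2 h₁0)
  have hye : Real.exp y = ‖a₂‖ := Real.exp_log (norm_pos_iff.2 h₂0)
  by_cases hL : x ≠ 0 ∨ y ≠ 0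
  swap
  · push Not at hL
    refine ⟨0, le_rfl, fun p N hN _ _ _ i j k _ => ?_⟩
    have : 0 ≤ N := (abs_nonneg _).trans (hN 0)
    rw [hL.1, hL.2]
    simp only [mul_zero, add_zero, max_self, zero_add]
    positivity
  obtain ⟨C, hC0, hC⟩ := exists_mul_exp_le_norm_intCast_add_monomial h₁ h₁' h₂ h₂' h₁0 h₂0 hind hL
    (show 0 < ε / 4 by positivity)
  have hnorm : ∀ m n : ℤ, ‖a₁ ^ m * a₂ ^ n‖ = Real.exp (m * x + n * y) := fun m n => by
    rw [norm_mul, norm_zpow, norm_zpow, ← hxe, ← hye, Real.exp_add, mul_comm (m : ℝ),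
      mul_comm (n : ℝ), Real.exp_mul, Real.exp_mul, Real.rpow_intCast, Real.rpow_intCast]
  refine ⟨max 0 (Real.log (2 / C)), le_max_left _ _, fun p N hN₁ hN₂ hsum hnd i j k hik => ?_⟩
  have hN0 : 0 ≤ N := (abs_nonneg _).trans (hN₁ 0)
  have hεN : 0 ≤ ε * N := by positivity
  have hK0 := le_max_left 0 (Real.log (2 / C))
  rcases eq_or_ne i j with rfl | hij
  · linarith [le_max_left ((p i).1 * x + (p i).2 * y) ((p k).1 * x + (p k).2 * y)]
  rcases eq_or_ne j k with rfl | hjk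
  · linarith [le_max_right ((p i).1 * x + (p i).2 * y) ((p j).1 * x + (p j).2 * y)]
  obtain ⟨l, hli, hlj, hlk, huniv⟩ := Fin.exists_univ_eq_of_four hij hjk hik
  rw [huniv, Finset.sum_insert (by simp [hlj.symm, hij.symm, hjk]),
    Finset.sum_insert (by simp [hli, hlk]), Finset.sum_insert (by simp [hik]),
    Finset.sum_singleton] at hsum
  have hsn : ∀ i, ‖(s i : ℂ)‖ = 1 := fun i => by rcases hs i with h | h <;> simp [h]
  set mx := max ((p i).1 * x + (p i).2 * y) ((p k).1 * x + (p k).2 * y) with hmx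
  have hupper : ‖(s j : ℂ) * (a₁ ^ (p j).1 * a₂ ^ (p j).2) +
      s l * (a₁ ^ (p l).1 * a₂ ^ (p l).2)‖ ≤ 2 * Real.exp mx := by
    rw [← add_assoc] at hsum
    rw [eq_neg_of_add_eq_zero_left hsum, norm_neg]
    refine (norm_add_le _ _).trans ?_
    rw [norm_mul (s i : ℂ), norm_mul (s k : ℂ), hsn, hsn, hnorm, hnorm, one_mul, one_mul, two_mul]
    exact add_le_add (Real.exp_le_exp.2 (le_max_left _ _)) (Real.exp_le_exp.2 (le_max_right _ _))
  have hfac : (s j : ℂ) * (a₁ ^ (p j).1 * a₂ ^ (p j).2) + s l * (a₁ ^ (p l).1 * a₂ ^ (p l).2) =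
      (a₁ ^ (p j).1 * a₂ ^ (p j).2) * (s j + s l * (a₁ ^ ((p l).1 - (p j).1) *
        a₂ ^ ((p l).2 - (p j).2))) := by
    have := zpow_ne_zero (p j).1 h₁0
    have := zpow_ne_zero (p j).2 h₂0
    rw [zpow_sub₀ h₁0, zpow_sub₀ h₂0]
    field_simp
  have hlower := hC (s j) (s l) ((p l).1 - (p j).1) ((p l).2 - (p j).2) (hs j) (hs l) (fun h h' => by
    obtain ⟨h3, h4⟩ := Prod.mk_eq_zero.1 h'
    exact hnd j l h (Prod.ext (by lia) (by lia)))
  rw [hfac, norm_mul, hnorm] at hupper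
  have hd : |(((p l).1 - (p j).1 : ℤ) : ℝ)| + |(((p l).2 - (p j).2 : ℤ) : ℝ)| ≤ 4 * N := by
    push_cast
    have h3 := abs_sub ((p l).1 : ℝ) (p j).1
    have h4 := abs_sub ((p l).2 : ℝ) (p j).2
    linarith [hN₁ l, hN₁ j, hN₂ l, hN₂ j]
  have hexp : Real.exp (-(ε * N)) ≤ Real.exp (-(ε / 4) *
      (|(((p l).1 - (p j).1 : ℤ) : ℝ)| + |(((p l).2 - (p j).2 : ℤ) : ℝ)|)) := by
    refine Real.exp_le_exp.2 ?_
    nlinarith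
  have hfinal : Real.exp ((p j).1 * x + (p j).2 * y) * (C * Real.exp (-(ε * N))) ≤
      2 * Real.exp mx :=
    le_trans (mul_le_mul_of_nonneg_left ((mul_le_mul_of_nonneg_left hexp hC0.le).trans hlower)
      (Real.exp_pos _).le) hupper
  have hfinal' : Real.exp ((p j).1 * x + (p j).2 * y - ε * N - mx) ≤ 2 / C := by
    rw [le_div_iff₀ hC0, Real.exp_sub, sub_eq_add_neg, Real.exp_add, div_mul_eq_mul_div,
      div_le_iff₀ (Real.exp_pos _)]
    linarith
  have := (Real.le_log_iff_exp_le (by positivity)).2 hfinal'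
  linarith [le_max_right 0 (Real.log (2 / C))]

/-- Nondegenerate solutions of a four-term equation in a rank-two group of units form a finite
set. -/
theorem finite_setOf_sum_monomial_eq_zero {F : Type*} [Field F] [NumberField F] {a₁ a₂ : F}
    (h₁0 : a₁ ≠ 0) (h₂0 : a₂ ≠ 0) (h₁ : IsIntegral ℤ a₁) (h₁' : IsIntegral ℤ a₁⁻¹)
    (h₂ : IsIntegral ℤ a₂) (h₂' : IsIntegral ℤ a₂⁻¹)
    (hind : ∀ m n : ℤ, a₁ ^ m * a₂ ^ n = 1 → m = 0 ∧ n = 0) {s : Fin 4 → ℤ}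
    (hs : ∀ i, s i = 1 ∨ s i = -1) :
    {p : Fin 4 → ℤ × ℤ | p 3 = 0 ∧ ∑ i, (s i : F) * (a₁ ^ (p i).1 * a₂ ^ (p i).2) = 0 ∧
      ∀ i k, s i + s k = 0 → p i ≠ p k}.Finite := by
  by_contra hinf
  let u : (Fin 4 → ℤ × ℤ) → Fin 4 → ℝ × ℝ := fun p i => ((p i).1, (p i).2)
  have hlarge : ∀ n : ℕ, ∃ p : Fin 4 → ℤ × ℤ, (p 3 = 0 ∧
      ∑ i, (s i : F) * (a₁ ^ (p i).1 * a₂ ^ (p i).2) = 0 ∧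
      ∀ i k, s i + s k = 0 → p i ≠ p k) ∧ (n : ℝ) < ‖u p‖ := by
    intro n
    by_contra! hn
    refine hinf ((Set.finite_Icc (fun _ => (-(n : ℤ), -(n : ℤ))) fun _ => ((n : ℤ), (n : ℤ))).subset
      fun p hp => ?_)
    have hc : ∀ i, |((p i).1 : ℝ)| ≤ n ∧ |((p i).2 : ℝ)| ≤ n := fun i =>
      max_le_iff.1 ((norm_le_pi_norm (u p) i).trans (hn p hp))
    refine ⟨fun i => ⟨?_, ?_⟩, fun i => ⟨?_, ?_⟩⟩
    · exact_mod_cast (abs_le.1 (hc i).1).1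
    · exact_mod_cast (abs_le.1 (hc i).2).1
    · exact_mod_cast (abs_le.1 (hc i).1).2
    · exact_mod_cast (abs_le.1 (hc i).2).2
  choose p hp hpn using hlarge
  have hN : ∀ n, 0 < ‖u (p n)‖ := fun n => (Nat.cast_nonneg n).trans_lt (hpn n)
  have hNtop : Filter.Tendsto (fun n => ‖u (p n)‖) Filter.atTop Filter.atTop :=
    Filter.tendsto_atTop_mono (fun n => (hpn n).le) tendsto_natCast_atTop_atTop
  obtain ⟨q, hq, φ, hφ, hlim⟩ := (isCompact_sphere (0 : Fin 4 → ℝ × ℝ) 1).tendsto_subseq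
    (x := fun n => ‖u (p n)‖⁻¹ • u (p n)) fun n => by
      rw [mem_sphere_zero_iff_norm, norm_smul, norm_inv, norm_norm, inv_mul_cancel₀ (hN n).ne']
  have hcoord : ∀ i, Filter.Tendsto (fun n => ‖u (p (φ n))‖⁻¹ • u (p (φ n)) i) Filter.atTop
      (nhds (q i)) := fun i => (tendsto_pi_nhds.1 hlim) i
  have hq3 : q 3 = 0 := by
    refine tendsto_nhds_unique (hcoord 3) ?_
    have : ∀ n, u (p (φ n)) 3 = 0 := fun n => by
      simp [u, (hp (φ n)).1]
    simp [this]
  have hform : ∀ (τ : F →ₐ[ℚ] ℂ) (i j k : Fin 4), i ≠ k →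
      (q j).1 * Real.log ‖τ a₁‖ + (q j).2 * Real.log ‖τ a₂‖ ≤
        max ((q i).1 * Real.log ‖τ a₁‖ + (q i).2 * Real.log ‖τ a₂‖)
          ((q k).1 * Real.log ‖τ a₁‖ + (q k).2 * Real.log ‖τ a₂‖) := by
    intro τ i j k hik
    refine le_of_forall_pos_le_add fun ε hε => ?_
    have hmap : ∀ {a : F}, IsIntegral ℤ a → IsIntegral ℤ (τ a) := fun ha =>
      ha.map (τ.restrictScalars ℤ)
    obtain ⟨K, -, hK⟩ := exists_linear_form_le_max_add (a₁ := τ a₁) (a₂ := τ a₂) (hmap h₁)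
      (by simpa using hmap h₁') (hmap h₂) (by simpa using hmap h₂') (by simpa using h₁0)
      (by simpa using h₂0) (fun m n h => hind m n (τ.injective (by simpa using h))) hs hε
    have hlimform : ∀ i, Filter.Tendsto (fun n =>
        (‖u (p (φ n))‖⁻¹ • u (p (φ n)) i).1 * Real.log ‖τ a₁‖ +
          (‖u (p (φ n))‖⁻¹ • u (p (φ n)) i).2 * Real.log ‖τ a₂‖) Filter.atTop
        (nhds ((q i).1 * Real.log ‖τ a₁‖ + (q i).2 * Real.log ‖τ a₂‖)) := fun i =>
      (((continuous_fst.tendsto _).comp (hcoord i)).mul_const _).add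
        (((continuous_snd.tendsto _).comp (hcoord i)).mul_const _)
    have hKlim : Filter.Tendsto (fun n => K / ‖u (p (φ n))‖) Filter.atTop (nhds 0) :=
      (hNtop.comp hφ.tendsto_atTop).const_div_atTop K
    refine le_of_tendsto_of_tendsto' (hlimform j)
      (by simpa using (((hlimform i).max (hlimform k)).add_const ε).add hKlim) fun n => ?_
    have hN' := hN (φ n)
    have hc : ∀ i, |((p (φ n) i).1 : ℝ)| ≤ ‖u (p (φ n))‖ ∧ |((p (φ n) i).2 : ℝ)| ≤ ‖u (p (φ n))‖ :=
      fun i => max_le_iff.1 (norm_le_pi_norm (u (p (φ n))) i)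
    have hsum : ∑ i, (s i : ℂ) * (τ a₁ ^ (p (φ n) i).1 * τ a₂ ^ (p (φ n) i).2) = 0 := by
      simpa using congrArg τ (hp (φ n)).2.1
    have h := hK (p (φ n)) _ (fun i => (hc i).1) (fun i => (hc i).2) hsum (hp (φ n)).2.2 i j k hik
    simp only [u, Prod.smul_fst, Prod.smul_snd, smul_eq_mul, mul_assoc, ← mul_add]
    rw [← mul_max_of_nonneg _ _ (inv_nonneg.2 hN'.le), div_eq_inv_mul, add_assoc]
    change ‖u (p (φ n))‖⁻¹ * _ ≤ ‖u (p (φ n))‖⁻¹ * _ + (ε + ‖u (p (φ n))‖⁻¹ * K)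
    rw [← sub_nonneg]
    have := mul_le_mul_of_nonneg_left h (inv_nonneg.2 hN'.le)
    have e : ‖u (p (φ n))‖⁻¹ * (ε * ‖u (p (φ n))‖) = ε := by field_simp
    simp only [mul_add, e] at this ⊢
    linarith
  have hconst := eq_of_forall_linear_form_le_max (sum_log_norm_embedding_eq_zero h₁0 h₁ h₁')
    (sum_log_norm_embedding_eq_zero h₂0 h₂ h₂')
    (fun w hw => eq_zero_of_forall_mul_log_norm_embedding_eq_zero h₁0 h₂0 h₁ h₁' h₂ h₂' hind hw)
    hform
  have hq0 : q = 0 := funext fun i => (hconst i 3).trans hq3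
  simp [hq0] at hq

/-- The finiteness theorem for multiplicatively independent complex units. -/
theorem Complex.finite_setOf_sum_monomial_eq_zero {a₁ a₂ : ℂ} (h₁0 : a₁ ≠ 0) (h₂0 : a₂ ≠ 0)
    (h₁ : IsIntegral ℤ a₁) (h₁' : IsIntegral ℤ a₁⁻¹) (h₂ : IsIntegral ℤ a₂)
    (h₂' : IsIntegral ℤ a₂⁻¹) (hind : ∀ m n : ℤ, a₁ ^ m * a₂ ^ n = 1 → m = 0 ∧ n = 0)
    {s : Fin 4 → ℤ} (hs : ∀ i, s i = 1 ∨ s i = -1) :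
    {p : Fin 4 → ℤ × ℤ | p 3 = 0 ∧ ∑ i, (s i : ℂ) * (a₁ ^ (p i).1 * a₂ ^ (p i).2) = 0 ∧
      ∀ i k, s i + s k = 0 → p i ≠ p k}.Finite := by
  let F := IntermediateField.adjoin ℚ ({a₁, a₂} : Set ℂ)
  have hfin : FiniteDimensional ℚ F := IntermediateField.finiteDimensional_adjoin (by
    rintro x (rfl | rfl)
    · exact h₁.tower_top
    · exact h₂.tower_top)
  have hNF : NumberField F := { to_charZero := inferInstance, to_finiteDimensional := hfin }
  obtain ⟨b₁, hb₁⟩ : ∃ b : F, algebraMap F ℂ b = a₁ :=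
    ⟨⟨a₁, IntermediateField.subset_adjoin _ _ (by simp)⟩, rfl⟩
  obtain ⟨b₂, hb₂⟩ : ∃ b : F, algebraMap F ℂ b = a₂ :=
    ⟨⟨a₂, IntermediateField.subset_adjoin _ _ (by simp)⟩, rfl⟩
  have hinj : Function.Injective (algebraMap F ℂ) := (algebraMap F ℂ).injective
  simp only [← hb₁, ← hb₂] at h₁0 h₂0 hind ⊢
  rw [← hb₁] at h₁ h₁'
  rw [← hb₂] at h₂ h₂'
  rw [← map_inv₀] at h₁' h₂'
  rw [isIntegral_algebraMap_iff hinj] at h₁ h₁' h₂ h₂'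
  convert _root_.finite_setOf_sum_monomial_eq_zero ((map_ne_zero_iff _ hinj).1 h₁0)
    ((map_ne_zero_iff _ hinj).1 h₂0) h₁ h₁' h₂ h₂'
    (fun m n h => hind m n (by rw [← map_zpow₀, ← map_zpow₀, ← map_mul, h, map_one])) hs using 4
  rw [← map_eq_zero_iff _ hinj]
  simp only [map_sum, map_mul, map_intCast, map_zpow₀]

theorem Module.End.exists_joint_eigenvector {K V : Type*} [Field K] [IsAlgClosed K]
    [AddCommGroup V] [Module K V] [FiniteDimensional K V] {f g : Module.End K V} (hfg : Commute f g)
    {W : Submodule K V} (hf : ∀ v ∈ W, f v ∈ W) (hg : ∀ v ∈ W, g v ∈ W) (hW : W ≠ ⊥) :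
    ∃ v ∈ W, v ≠ 0 ∧ ∃ a b : K, f v = a • v ∧ g v = b • v := by
  have := Submodule.nontrivial_iff_ne_bot.2 hW
  obtain ⟨a, ha⟩ := Module.End.exists_eigenvalue (f.restrict hf)
  let U : Submodule K V := W ⊓ Module.End.eigenspace f a
  have hU : U ≠ ⊥ := by
    obtain ⟨w, hw⟩ := ha.exists_hasEigenvector
    refine (Submodule.ne_bot_iff _).2 ⟨w, ⟨w.2, ?_⟩, by simpa using hw.2⟩
    rw [SetLike.mem_coe, Module.End.mem_eigenspace_iff]
    simpa using congrArg Subtype.val hw.apply_eq_smul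
  have hgU : ∀ v ∈ U, g v ∈ U := by
    rintro v ⟨hvW, hv⟩
    refine ⟨hg v hvW, ?_⟩
    rw [SetLike.mem_coe, Module.End.mem_eigenspace_iff] at hv ⊢
    have := LinearMap.congr_fun hfg.eq v
    simp only [Module.End.mul_apply] at this
    rw [this, hv, map_smul]
  have := Submodule.nontrivial_iff_ne_bot.2 hU
  obtain ⟨b, hb⟩ := Module.End.exists_eigenvalue (g.restrict hgU)
  obtain ⟨w, hw⟩ := hb.exists_hasEigenvector
  refine ⟨w, w.2.1, by simpa using hw.2, a, b, Module.End.mem_eigenspace_iff.1 w.2.2, ?_⟩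
  simpa using congrArg Subtype.val hw.apply_eq_smul

theorem Matrix.isRoot_charpoly_of_mulVec_eq_smul {n K : Type*} [Fintype n] [DecidableEq n] [Field K]
    {M : Matrix n n K} {v : n → K} (hv : v ≠ 0) {a : K} (h : M *ᵥ v = a • v) :
    M.charpoly.IsRoot a := by
  rw [← Matrix.charpoly_toLin', ← Module.End.hasEigenvalue_iff_isRoot_charpoly]
  exact Module.End.hasEigenvalue_of_hasEigenvector
    (x := v) ⟨Module.End.mem_eigenspace_iff.2 (by simpa using h), hv⟩

theorem Matrix.isIntegral_of_mulVec_eq_smul {n : Type*} [Fintype n] [DecidableEq n]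
    {M : Matrix n n ℤ} {v : n → ℂ} (hv : v ≠ 0) {a : ℂ}
    (h : M.map (Int.cast : ℤ → ℂ) *ᵥ v = a • v) : IsIntegral ℤ a := by
  have := Matrix.isRoot_charpoly_of_mulVec_eq_smul hv h
  rw [show M.map (Int.cast : ℤ → ℂ) = M.map (Int.castRingHom ℂ) from rfl, Matrix.charpoly_map,
    Polynomial.IsRoot.def, Polynomial.eval_map] at this
  exact ⟨M.charpoly, M.charpoly_monic, this⟩

theorem Matrix.GeneralLinearGroup.inv_mulVec_eq_inv_smul {n K : Type*} [Fintype n] [DecidableEq n]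
    [Field K] {B : GL n K} {v : n → K} {a : K} (ha : a ≠ 0) (h : B.val *ᵥ v = a • v) :
    (B⁻¹).val *ᵥ v = a⁻¹ • v := by
  rw [eq_inv_smul_iff₀ ha, ← Matrix.mulVec_smul, ← h, Matrix.mulVec_mulVec, ← Units.val_mul]
  simp

theorem Matrix.GeneralLinearGroup.eigenvalue_ne_zero {n K : Type*} [Fintype n] [DecidableEq n]
    [Field K] {B : GL n K} {v : n → K} {a : K} (hv : v ≠ 0) (h : B.val *ᵥ v = a • v) : a ≠ 0 := by
  rintro rfl
  have := congrArg ((B⁻¹).val *ᵥ ·) h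
  simp only [Matrix.mulVec_mulVec, ← Units.val_mul] at this
  simp [hv] at this

theorem Matrix.GeneralLinearGroup.zpow_mulVec_eq_zpow_smul {n K : Type*} [Fintype n]
    [DecidableEq n] [Field K] {B : GL n K} {v : n → K} {a : K} (ha : a ≠ 0)
    (h : B.val *ᵥ v = a • v) (m : ℤ) : (B ^ m).val *ᵥ v = a ^ m • v := by
  have hpow : ∀ m : ℕ, (B ^ m).val *ᵥ v = a ^ m • v := by
    intro m
    induction m with
    | zero => simp
    | succ m ih =>
      rw [_root_.pow_succ, Units.val_mul, ← Matrix.mulVec_mulVec, h, Matrix.mulVec_smul, ih,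
        smul_smul, _root_.pow_succ, mul_comm]
  cases m with
  | ofNat m => simpa using hpow m
  | negSucc m =>
    rw [_root_.zpow_negSucc, _root_.zpow_negSucc]
    exact inv_mulVec_eq_inv_smul (pow_ne_zero _ ha) (hpow _)

theorem apow_mulVec_eq_smul {ρ : ℕ} {A₁ A₂ : Matrix.GeneralLinearGroup (Fin ρ) ℤ} {v : Fin ρ → ℂ}
    (hv : v ≠ 0) {a b : ℂ} (ha : A₁.val.map (Int.cast : ℤ → ℂ) *ᵥ v = a • v)
    (hb : A₂.val.map (Int.cast : ℤ → ℂ) *ᵥ v = b • v) (ℓ : ℤ × ℤ) :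
    (Apow A₁ A₂ ℓ).map (Int.cast : ℤ → ℂ) *ᵥ v = (a ^ ℓ.1 * b ^ ℓ.2) • v := by
  let φ := Matrix.GeneralLinearGroup.map (n := Fin ρ) (Int.castRingHom ℂ)
  have ha' : (φ A₁).val *ᵥ v = a • v := ha
  have hb' : (φ A₂).val *ᵥ v = b • v := hb
  have h : (Apow A₁ A₂ ℓ).map (Int.cast : ℤ → ℂ) = (φ (A₁ ^ ℓ.1 * A₂ ^ ℓ.2)).val := rfl
  rw [h, map_mul, map_zpow, map_zpow, Units.val_mul, ← Matrix.mulVec_mulVec,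
    Matrix.GeneralLinearGroup.zpow_mulVec_eq_zpow_smul
      (Matrix.GeneralLinearGroup.eigenvalue_ne_zero hv hb') hb', Matrix.mulVec_smul,
    Matrix.GeneralLinearGroup.zpow_mulVec_eq_zpow_smul
      (Matrix.GeneralLinearGroup.eigenvalue_ne_zero hv ha') ha', smul_smul, mul_comm]

theorem commute_apow {ρ : ℕ} {A₁ A₂ B : Matrix.GeneralLinearGroup (Fin ρ) ℤ} (h₁ : Commute B A₁)
    (h₂ : Commute B A₂) (ℓ : ℤ × ℤ) : Commute B.val (Apow A₁ A₂ ℓ) :=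
  ((h₁.zpow_right _).mul_right (h₂.zpow_right _)).map (Units.coeHom _)

/-- A linear relation between the vectors `A^ℓ γ` descends to a relation between the
corresponding joint eigenvalues of `A₁` and `A₂` on some joint eigenvector. -/
theorem exists_joint_eigenvector_of_sum_smul_apow_mulVec_eq_zero {ρ : ℕ}
    {A₁ A₂ : Matrix.GeneralLinearGroup (Fin ρ) ℤ} (hcomm : A₁ * A₂ = A₂ * A₁) {s : Fin 4 → ℤ}
    {p : Fin 4 → ℤ × ℤ} {γ : Fin ρ → ℤ} (hγ : γ ≠ 0)
    (hsum : ∑ i, s i • (Apow A₁ A₂ (p i) *ᵥ γ) = 0) :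
    ∃ (v : Fin ρ → ℂ) (a b : ℂ), v ≠ 0 ∧ A₁.val.map (Int.cast : ℤ → ℂ) *ᵥ v = a • v ∧
      A₂.val.map (Int.cast : ℤ → ℂ) *ᵥ v = b • v ∧
      ∑ i, (s i : ℂ) * (a ^ (p i).1 * b ^ (p i).2) = 0 := by
  let φ : Matrix (Fin ρ) (Fin ρ) ℤ →+* Matrix (Fin ρ) (Fin ρ) ℂ := (Int.castRingHom ℂ).mapMatrix
  let ψ : Matrix (Fin ρ) (Fin ρ) ℤ →+* Module.End ℂ (Fin ρ → ℂ) :=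
    (Matrix.toLinAlgEquiv' : _ ≃ₐ[ℂ] _).toRingEquiv.toRingHom.comp φ
  have hψ : ∀ M v, ψ M v = M.map (Int.cast : ℤ → ℂ) *ᵥ v := fun _ _ => rfl
  let M : Matrix (Fin ρ) (Fin ρ) ℤ := ∑ i, s i • Apow A₁ A₂ (p i)
  have hMcomm : ∀ B : Matrix.GeneralLinearGroup (Fin ρ) ℤ, Commute B A₁ → Commute B A₂ →
      Commute (ψ B.val) (ψ M) := fun B h₁ h₂ =>
    (Commute.sum_right _ _ _ fun i _ => (commute_apow h₁ h₂ (p i)).smul_right (s i)).map ψ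
  have hinv : ∀ {f : Module.End ℂ (Fin ρ → ℂ)}, Commute f (ψ M) → ∀ v ∈ LinearMap.ker (ψ M),
      f v ∈ LinearMap.ker (ψ M) := by
    intro f hf v hv
    rw [LinearMap.mem_ker] at hv ⊢
    rw [← Module.End.mul_apply, ← hf.eq, Module.End.mul_apply, hv, map_zero]
  have hne : LinearMap.ker (ψ M) ≠ ⊥ := by
    refine (Submodule.ne_bot_iff _).2 ⟨fun i => (γ i : ℂ), ?_, fun h => hγ (funext fun i => ?_)⟩
    · have hMγ : M *ᵥ γ = 0 := by
        rw [← hsum, Matrix.sum_mulVec]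
        simp only [Matrix.smul_mulVec]
      rw [LinearMap.mem_ker, hψ]
      funext i
      have := congrArg (Int.cast : ℤ → ℂ) (congrFun hMγ i)
      simpa [Matrix.mulVec, dotProduct] using this
    · simpa using congrFun h i
  obtain ⟨v, hvM, hv, a, b, ha, hb⟩ := Module.End.exists_joint_eigenvector
    (((show Commute A₁ A₂ from hcomm).map (Units.coeHom _)).map ψ)
    (hinv (hMcomm A₁ (Commute.refl _) hcomm)) (hinv (hMcomm A₂ hcomm.symm (Commute.refl _))) hne
  refine ⟨v, a, b, hv, ha, hb, ?_⟩
  have hM : ψ M v = (∑ i, (s i : ℂ) * (a ^ (p i).1 * b ^ (p i).2)) • v := by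
    simp only [M, map_sum, map_zsmul, LinearMap.sum_apply, LinearMap.smul_apply, hψ,
      apow_mulVec_eq_smul hv ha hb, Finset.sum_smul]
    exact Finset.sum_congr rfl fun i _ => by rw [← Int.cast_smul_eq_zsmul ℂ, smul_smul]
  rw [LinearMap.mem_ker, hM] at hvM
  exact (smul_eq_zero.1 hvM).resolve_right hv

/-- **finiteness of solutions of the S-unit equation.** If the `ℤ²`-action
on `𝕋^ρ` generated by the commuting matrices `A₁, A₂ ∈ GL(ρ,ℤ)` is totally ergodic (no
eigenvalue of `A^ℓ`, `ℓ ≠ 0`, is a root of unity), then the set of triples `(ℓ₁, ℓ₂, ℓ₃)`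
for which there exists `γ ∈ ℤ^ρ \ {0}` with `A^{ℓ₁}γ - A^{ℓ₂}γ + A^{ℓ₃}γ - γ = 0` and no
vanishing proper subsum, is finite. -/
theorem quenched_fclt_stmt17 {ρ : ℕ}
    (A₁ A₂ : Matrix.GeneralLinearGroup (Fin ρ) ℤ)
    (hcomm : A₁ * A₂ = A₂ * A₁)
    -- total ergodicity: for ℓ ≠ 0, A^ℓ has no eigenvalue which is a root of unity
    (herg : ∀ ℓ : ℤ × ℤ, ℓ ≠ 0 → ∀ z : ℂ, (∃ m : ℕ, 0 < m ∧ z ^ m = 1) →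
      ¬ (Matrix.charpoly ((Apow A₁ A₂ ℓ).map (Int.cast : ℤ → ℂ))).IsRoot z) :
    Set.Finite {L : (ℤ × ℤ) × (ℤ × ℤ) × (ℤ × ℤ) |
      ∃ γ : Fin ρ → ℤ, γ ≠ 0 ∧
        (∑ i : Fin 4,
          ![(Apow A₁ A₂ L.1).mulVec γ, -((Apow A₁ A₂ L.2.1).mulVec γ),
            (Apow A₁ A₂ L.2.2).mulVec γ, -γ] i) = 0 ∧
        (∀ s : Finset (Fin 4), s ≠ ∅ → s ≠ Finset.univ →
          (∑ i ∈ s,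
            ![(Apow A₁ A₂ L.1).mulVec γ, -((Apow A₁ A₂ L.2.1).mulVec γ),
              (Apow A₁ A₂ L.2.2).mulVec γ, -γ] i) ≠ 0)} := by
  set s : Fin 4 → ℤ := ![1, -1, 1, -1] with hs
  have hs' : ∀ i, s i = 1 ∨ s i = -1 := by
    rw [hs]
    decide
  let roots (A : Matrix.GeneralLinearGroup (Fin ρ) ℤ) : Set ℂ :=
    {a | (A.val.map (Int.cast : ℤ → ℂ)).charpoly.IsRoot a}
  have hroots : ∀ A, (roots A).Finite := fun A =>
    Polynomial.finite_setOfPred_isRoot (Matrix.charpoly_monic _).ne_zero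
  have hfin : ∀ c : ℂ × ℂ, {p : Fin 4 → ℤ × ℤ | (∃ v : Fin ρ → ℂ, v ≠ 0 ∧
      A₁.val.map (Int.cast : ℤ → ℂ) *ᵥ v = c.1 • v ∧
      A₂.val.map (Int.cast : ℤ → ℂ) *ᵥ v = c.2 • v) ∧ p 3 = 0 ∧
      ∑ i, (s i : ℂ) * (c.1 ^ (p i).1 * c.2 ^ (p i).2) = 0 ∧
      ∀ i k, s i + s k = 0 → p i ≠ p k}.Finite := by
    rintro ⟨a, b⟩
    by_cases h : ∃ v : Fin ρ → ℂ, v ≠ 0 ∧ A₁.val.map (Int.cast : ℤ → ℂ) *ᵥ v = a • v ∧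
        A₂.val.map (Int.cast : ℤ → ℂ) *ᵥ v = b • v
    swap
    · simp [h]
    obtain ⟨v, hv, ha, hb⟩ := h
    let φ := Matrix.GeneralLinearGroup.map (n := Fin ρ) (Int.castRingHom ℂ)
    have ha0 := Matrix.GeneralLinearGroup.eigenvalue_ne_zero (B := φ A₁) hv ha
    have hb0 := Matrix.GeneralLinearGroup.eigenvalue_ne_zero (B := φ A₂) hv hb
    refine (Complex.finite_setOf_sum_monomial_eq_zero ha0 hb0
      (Matrix.isIntegral_of_mulVec_eq_smul hv ha)
      (Matrix.isIntegral_of_mulVec_eq_smul (M := (A₁⁻¹).val) hv ?_)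
      (Matrix.isIntegral_of_mulVec_eq_smul hv hb)
      (Matrix.isIntegral_of_mulVec_eq_smul (M := (A₂⁻¹).val) hv ?_) ?_ hs').subset fun p hp => hp.2
    · have := Matrix.GeneralLinearGroup.inv_mulVec_eq_inv_smul (B := φ A₁) ha0 ha
      rwa [← map_inv] at this
    · have := Matrix.GeneralLinearGroup.inv_mulVec_eq_inv_smul (B := φ A₂) hb0 hb
      rwa [← map_inv] at this
    · intro m n hmn
      by_contra hne
      refine herg (m, n) (by simpa [Prod.ext_iff] using hne) 1 ⟨1, one_pos, by simp⟩ ?_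
      have := apow_mulVec_eq_smul hv ha hb (m, n)
      rw [hmn] at this
      exact Matrix.isRoot_charpoly_of_mulVec_eq_smul hv this
  refine ((((hroots A₁).prod (hroots A₂)).biUnion fun c _ => hfin c).image
    fun p => (p 0, p 1, p 2)).subset ?_
  rintro ⟨ℓ₁, ℓ₂, ℓ₃⟩ ⟨γ, hγ, hsum, hsub⟩
  set p : Fin 4 → ℤ × ℤ := ![ℓ₁, ℓ₂, ℓ₃, 0] with hp
  have hterm : ![(Apow A₁ A₂ ℓ₁).mulVec γ, -((Apow A₁ A₂ ℓ₂).mulVec γ),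
      (Apow A₁ A₂ ℓ₃).mulVec γ, -γ] = fun i => s i • (Apow A₁ A₂ (p i) *ᵥ γ) := by
    funext i
    fin_cases i <;> simp [hs, hp, Apow]
  simp only [hterm] at hsum hsub
  obtain ⟨v, a, b, hv, ha, hb, hab⟩ :=
    exists_joint_eigenvector_of_sum_smul_apow_mulVec_eq_zero hcomm hγ hsum
  refine ⟨p, Set.mem_biUnion (x := (a, b)) ⟨Matrix.isRoot_charpoly_of_mulVec_eq_smul hv ha,
    Matrix.isRoot_charpoly_of_mulVec_eq_smul hv hb⟩ ⟨⟨v, hv, ha, hb⟩, rfl, hab, ?_⟩, rfl⟩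
  intro i k hik hpik
  have hne : i ≠ k := by
    rintro rfl
    rcases hs' i with h | h <;> simp [h] at hik
  refine hsub {i, k} (by simp) (fun h => ?_) ?_
  · have := congrArg Finset.card h
    simp [Finset.card_pair hne] at this
  · rw [Finset.sum_pair hne, hpik, ← add_smul, hik, zero_smul]
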